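/- There is an absolute constant C > 0 such that the following holds. Let U ≥ 1, T > 0, and let M, M₁ satisfy 1 ≤ M ≤ (2T)^{1/2} and M/2 ≤ M₁ ≤ M. Put D := min{(e^{1/U} − 1)M/2, U^{7/2}/T}. Then |Σ_{0<h≤D} Σ_{M₁<m≤M, m>h} ((m+h)/(m−h))^{2πiT}| ≤ C M, where h and m run over positive integers (the inner sum being restricted to m > h so that every summand is well defined). -/

import Mathlib

open Real


noncomputable def ee (x : ℝ) : ℂ := Complex.exp (((2 * π * x : ℝ) : ℂ) * Complex.I)

lemma norm_ee (x : ℝ) : ‖ee x‖ = 1 := by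
  unfold ee; exact Complex.norm_exp_ofReal_mul_I _

lemma ee_add (x y : ℝ) : ee (x + y) = ee x * ee y := by
  unfold ee; rw [← Complex.exp_add]; congr 1; push_cast; ring

lemma ee_zero : ee 0 = 1 := by simp [ee]

lemma ee_int (k : ℤ) : ee (k : ℝ) = 1 := by
  unfold ee
  rw [Complex.exp_eq_one_iff]
  exact ⟨k, by push_cast; ring⟩

lemma ee_add_int (x : ℝ) (k : ℤ) : ee (x + k) = ee x := by
  rw [ee_add, ee_int, mul_one]

lemma ee_neg (x : ℝ) : ee (-x) = (starRingEnd ℂ) (ee x) := by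
  unfold ee
  rw [← Complex.exp_conj, map_mul, Complex.conj_ofReal, Complex.conj_I]
  congr 1
  push_cast; ring

lemma ee_sub (x y : ℝ) : ee (x - y) = ee x * (starRingEnd ℂ) (ee y) := by
  rw [sub_eq_add_neg, ee_add, ee_neg]

lemma norm_ee_sub_one_le (x : ℝ) : ‖ee x - 1‖ ≤ 2 * π * |x| := by
  unfold ee
  have := Real.norm_exp_I_mul_ofReal_sub_one_le (x := 2 * π * x)
  rw [mul_comm] at this
  refine this.trans ?_
  rw [Real.norm_eq_abs, abs_mul, abs_of_pos (by positivity)]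

lemma norm_ee_sub_le (x y : ℝ) : ‖ee x - ee y‖ ≤ 2 * π * |x - y| := by
  have h : ee x - ee y = ee y * (ee (x - y) - 1) := by
    rw [mul_sub, ← ee_add]; simp
  rw [h, norm_mul, norm_ee, one_mul]
  exact norm_ee_sub_one_le _

lemma norm_ee_sub_one (x : ℝ) : ‖ee x - 1‖ = 2 * |Real.sin (π * x)| := by
  unfold ee
  have := Complex.norm_exp_I_mul_ofReal_sub_one (2 * π * x)
  rw [mul_comm] at this
  rw [this, Real.norm_eq_abs, abs_mul, abs_of_pos (by norm_num : (0:ℝ) < 2)]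
  congr 3; ring

lemma le_norm_ee_sub_one {d : ℝ} (hd : |d| ≤ 3 / 4) : |d| ≤ ‖ee d - 1‖ := by
  rw [norm_ee_sub_one]
  have key : ∀ x : ℝ, 0 ≤ x → x ≤ 3 / 4 → x ≤ 2 * |Real.sin (π * x)| := by
    intro x hx hx'
    rcases le_total x (1/2) with h | h
    · have h1 := Real.mul_le_sin (x := π * x) (by positivity) (by nlinarith [pi_pos])
      have h2 : 2 / π * (π * x) = 2 * x := by field_simp
      rw [h2] at h1
      have := le_abs_self (Real.sin (π * x))
      linarith
    · have h1 := Real.mul_le_sin (x := π * (1 - x)) (by nlinarith [pi_pos]) (by nlinarith [pi_pos])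
      have h2 : 2 / π * (π * (1 - x)) = 2 * (1 - x) := by field_simp
      have h3 : Real.sin (π * (1 - x)) = Real.sin (π * x) := by
        rw [← Real.sin_pi_sub]; congr 1; ring
      rw [h2, h3] at h1
      have := le_abs_self (Real.sin (π * x))
      linarith
  rcases le_total 0 d with h | h
  · rw [abs_of_nonneg h] at *
    exact key d h hd
  · rw [abs_of_nonpos h] at *
    have := key (-d) (by linarith) hd
    rwa [mul_neg, Real.sin_neg, abs_neg] at this

/-- Kusmin-Landau type bound. -/
lemma kl_aux (g : ℕ → ℝ) (δ : ℝ) (hδ : 0 < δ) (P : ℕ)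
    (hmono : ∀ n < P, g (n+1) - g n ≤ g (n+2) - g (n+1))
    (hb : ∀ n ≤ P, δ ≤ |g (n+1) - g n| ∧ |g (n+1) - g n| ≤ 3 / 4)
    (hs : ∀ n < P, 0 < (g (n+1) - g n) * (g (n+2) - g (n+1))) :
    ‖∑ n ∈ Finset.range (P+1), ee (g n) - (ee (g (P+1) - g P) - 1)⁻¹ * ee (g (P+1))‖ ≤
      1 / δ + 2 * π * (1 / (g 1 - g 0) - 1 / (g (P+1) - g P)) := by
  have hne : ∀ n ≤ P, ee (g (n+1) - g n) - 1 ≠ 0 := by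
    intro n hn h0
    have := le_norm_ee_sub_one (hb n hn).2
    rw [h0, norm_zero] at this
    linarith [(hb n hn).1]
  have hE : ∀ n ≤ P, ee (g n) = (ee (g (n+1) - g n) - 1)⁻¹ * (ee (g (n+1)) - ee (g n)) := by
    intro n hn
    have h1 : ee (g (n+1)) = ee (g n) * ee (g (n+1) - g n) := by
      rw [← ee_add]; congr 1; ring
    have := hne n hn
    rw [h1]
    field_simp
  have hw : ∀ n ≤ P, ‖(ee (g (n+1) - g n) - 1)⁻¹‖ ≤ 1 / δ := by
    intro n hn
    rw [norm_inv, ← one_div]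
    exact one_div_le_one_div_of_le hδ ((hb n hn).1.trans (le_norm_ee_sub_one (hb n hn).2))
  induction P with
  | zero =>
    simp only [zero_add, Finset.range_one, Finset.sum_singleton, sub_self, mul_zero, add_zero]
    have h1 := hE 0 le_rfl
    have : ee (g 0) - (ee (g (0+1) - g 0) - 1)⁻¹ * ee (g (0+1)) =
        - ((ee (g (0+1) - g 0) - 1)⁻¹ * ee (g 0)) := by
      linear_combination h1

    rw [zero_add] at this
    rw [this, norm_neg, norm_mul, norm_ee, mul_one]
    simpa using hw 0 le_rfl
  | succ P ih =>
    have ih' := ih (fun n hn => hmono n (by omega)) (fun n hn => hb n (by omega))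
      (fun n hn => hs n (by omega)) (fun n hn => hne n (by omega)) (fun n hn => hE n (by omega))
      (fun n hn => hw n (by omega))
    rw [Finset.sum_range_succ]
    set d := g (P+1) - g P with hd
    set d' := g (P+1+1) - g (P+1) with hd'
    have hpos : 0 < d * d' := hs P (by omega)
    have hm : d ≤ d' := hmono P (by omega)
    have hdb := hb P (by omega)
    have hdb' := hb (P+1) (by omega)
    rw [← hd] at hdb
    rw [← hd'] at hdb'
    have e1 := hE (P+1) le_rfl
    have eq : ∑ n ∈ Finset.range (P+1), ee (g n) + ee (g (P+1)) - (ee d' - 1)⁻¹ * ee (g (P+1+1)) =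
      (∑ n ∈ Finset.range (P+1), ee (g n) - (ee d - 1)⁻¹ * ee (g (P+1))) +
        ((ee d - 1)⁻¹ - (ee d' - 1)⁻¹) * ee (g (P+1)) := by
      have : ee (g (P+1)) = (ee d' - 1)⁻¹ * (ee (g (P+1+1)) - ee (g (P+1))) := e1
      linear_combination this
    rw [eq]
    refine (norm_add_le _ _).trans ?_
    have h2 : ‖((ee d - 1)⁻¹ - (ee d' - 1)⁻¹) * ee (g (P+1))‖ ≤ 2 * π * (1 / d - 1 / d') := by
      rw [norm_mul, norm_ee, mul_one, inv_sub_inv (hne P (by omega)) (hne (P+1) le_rfl), norm_div,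
        norm_mul]
      have hd0 : d ≠ 0 := by rintro h; rw [h] at hpos; simp at hpos
      have hd0' : d' ≠ 0 := by rintro h; rw [h] at hpos; simp at hpos
      have : 1 / d - 1 / d' = (d' - d) / (|d| * |d'|) := by
        rw [← abs_mul, abs_of_pos hpos]; field_simp
      rw [this, ← mul_div_assoc]
      have h3 := norm_ee_sub_le d' d
      rw [abs_of_nonneg (by linarith : 0 ≤ d' - d)] at h3
      have h4 : ee d' - 1 - (ee d - 1) = ee d' - ee d := by ring
      rw [h4]
      have hp1 : 0 < |d| := by linarith
      have hp2 : 0 < |d'| := by linarith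
      exact div_le_div₀ (mul_nonneg (by positivity) (by linarith)) h3 (by positivity)
        (mul_le_mul (le_norm_ee_sub_one hdb.2) (le_norm_ee_sub_one hdb'.2) hp2.le (norm_nonneg _))
    calc _ ≤ _ := add_le_add ih' h2
      _ = _ := by ring

lemma kl (g : ℕ → ℝ) (δ : ℝ) (hδ : 0 < δ) (P : ℕ)
    (hmono : ∀ n, n + 1 < P → g (n+1) - g n ≤ g (n+2) - g (n+1))
    (hb : ∀ n < P, δ ≤ |g (n+1) - g n| ∧ |g (n+1) - g n| ≤ 3 / 4)
    (hs : (∀ n < P, 0 < g (n+1) - g n) ∨ (∀ n < P, g (n+1) - g n < 0)) :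
    ‖∑ n ∈ Finset.range P, ee (g n)‖ ≤ 10 / δ := by
  rcases P with _ | P
  · simp; positivity
  have h1 := kl_aux g δ hδ P (fun n hn => hmono n (by omega)) (fun n hn => hb n (by omega)) (by
    intro n hn
    rcases hs with hs | hs
    · exact mul_pos (hs n (by omega)) (hs (n+1) (by omega))
    · exact mul_pos_of_neg_of_neg (hs n (by omega)) (hs (n+1) (by omega)))
  have h2 : ‖(ee (g (P+1) - g P) - 1)⁻¹ * ee (g (P+1))‖ ≤ 1 / δ := by
    rw [norm_mul, norm_ee, mul_one, norm_inv, ← one_div]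
    exact one_div_le_one_div_of_le hδ ((hb P (by omega)).1.trans
      (le_norm_ee_sub_one (hb P (by omega)).2))
  have h3 : 1 / (g 1 - g 0) - 1 / (g (P+1) - g P) ≤ 1 / δ := by
    have b0 := (hb 0 (by omega)).1
    have bP := (hb P (by omega)).1
    rw [zero_add] at b0
    rcases hs with hs | hs
    · have := hs 0 (by omega)
      rw [zero_add] at this
      rw [abs_of_pos this] at b0
      have h5 : 0 < 1 / (g (P+1) - g P) := one_div_pos.mpr (hs P (by omega))
      have := one_div_le_one_div_of_le hδ b0
      linarith
    · have h4 := hs 0 (by omega)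
      rw [zero_add] at h4
      have h6 := hs P (by omega)
      rw [abs_of_neg h6] at bP
      have h5 : 1 / (g 1 - g 0) < 0 := one_div_neg.mpr h4
      have := one_div_le_one_div_of_le hδ bP
      rw [one_div_neg_eq_neg_one_div] at this
      linarith
  have h7 : 2 * π * (1 / (g 1 - g 0) - 1 / (g (P+1) - g P)) ≤ 8 * (1 / δ) := by
    have := pi_lt_four
    calc _ ≤ 2 * π * (1 / δ) := by gcongr
      _ ≤ _ := by gcongr; linarith
  have h8 := norm_sub_norm_le (∑ n ∈ Finset.range (P+1), ee (g n))
    ((ee (g (P+1) - g P) - 1)⁻¹ * ee (g (P+1)))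
  have : (10:ℝ) / δ = 10 * (1 / δ) := by ring
  linarith

lemma threshold (d : ℕ → ℝ) (t : ℝ) (P : ℕ) (hd : ∀ n, n + 1 < P → d n ≤ d (n+1)) :
    ∃ i ≤ P, (∀ n < i, d n < t) ∧ (∀ n, i ≤ n → n < P → t ≤ d n) := by
  induction P with
  | zero => exact ⟨0, le_rfl, by simp, by simp⟩
  | succ P ih =>
    obtain ⟨i, hi, h1, h2⟩ := ih (fun n hn => hd n (by omega))
    rcases lt_or_ge (d P) t with h | h
    · refine ⟨P+1, le_rfl, ?_, by intro n; omega⟩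
      intro n hn
      have : ∀ k, k ≤ P → d (P - k) < t := by
        intro k
        induction k with
        | zero => intro _; simpa using h
        | succ k ihk =>
          intro hk
          have e := hd (P - (k+1)) (by omega)
          have : P - (k+1) + 1 = P - k := by omega
          rw [this] at e
          exact e.trans_lt (ihk (by omega))
      have h5 := this (P - n) (by omega)
      rwa [show P - (P - n) = n by omega] at h5
    · refine ⟨i, by omega, h1, ?_⟩
      intro n hn hn'
      rcases Nat.lt_succ_iff_lt_or_eq.mp hn' with h3 | h3
      · exact h2 n hn h3
      · rw [h3]; exact h

lemma chunk0 (g : ℕ → ℝ) (lam δ : ℝ) (hl : 0 < lam) (hδ : 0 < δ) (P : ℕ)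
    (hinc : ∀ n < P, lam ≤ g (n+2) - 2 * g (n+1) + g n)
    (hb : ∀ n < P, |g (n+1) - g n| ≤ 3 / 4) :
    ‖∑ n ∈ Finset.range P, ee (g n)‖ ≤ 20 / δ + 2 * δ / lam + 1 := by
  obtain ⟨i, hi, hi1, hi2⟩ := threshold (fun n => g (n+1) - g n) (-δ) P
    (fun n hn => by have := hinc n (by omega); rw [show n+1+1 = n+2 by ring]; linarith)
  obtain ⟨j, hj, hj1, hj2⟩ := threshold (fun n => g (n+1) - g n) δ P
    (fun n hn => by have := hinc n (by omega); rw [show n+1+1 = n+2 by ring]; linarith)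
  have hij : i ≤ j := by
    by_contra hlt
    push Not at hlt
    have a := hi1 j hlt
    have b := hj2 j le_rfl (by omega)
    linarith
  have hsum : ∑ n ∈ Finset.range P, ee (g n) = ∑ n ∈ Finset.range i, ee (g n) +
      ∑ n ∈ Finset.Ico i j, ee (g n) + ∑ n ∈ Finset.range (P - j), ee (g (j + n)) := by
    rw [← Finset.sum_Ico_eq_sum_range (fun n => ee (g n)), Finset.range_eq_Ico,
      Finset.range_eq_Ico, Finset.sum_Ico_consecutive _ (Nat.zero_le i) hij,
      Finset.sum_Ico_consecutive _ (Nat.zero_le j) hj]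
  have b1 : ‖∑ n ∈ Finset.range i, ee (g n)‖ ≤ 10 / δ := by
    apply kl g δ hδ i
    · intro n hn; have := hinc n (by omega); linarith
    · intro n hn
      have := hi1 n hn
      refine ⟨?_, hb n (by omega)⟩
      rw [abs_of_neg (by linarith)]; linarith
    · right; intro n hn; have := hi1 n hn; linarith
  have b3 : ‖∑ n ∈ Finset.range (P - j), ee (g (j + n))‖ ≤ 10 / δ := by
    apply kl (fun n => g (j + n)) δ hδ (P - j)
    · intro n hn; have := hinc (j + n) (by omega)
      simp only [← add_assoc]; linarith
    · intro n hn
      have := hj2 (j + n) (by omega) (by omega)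
      simp only [← add_assoc] at this ⊢
      refine ⟨?_, hb (j+n) (by omega)⟩
      rw [abs_of_pos (by linarith)]; linarith
    · left; intro n hn; have := hj2 (j + n) (by omega) (by omega)
      simp only [← add_assoc] at this ⊢; linarith
  have b2 : ‖∑ n ∈ Finset.Ico i j, ee (g n)‖ ≤ 2 * δ / lam + 1 := by
    have c1 : ‖∑ n ∈ Finset.Ico i j, ee (g n)‖ ≤ ((j - i : ℕ) : ℝ) := by
      refine (norm_sum_le _ _).trans ?_
      simp [norm_ee]
    refine c1.trans ?_
    rcases Nat.eq_or_lt_of_le hij with h | h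
    · rw [h]; simp; positivity
    have c2 : ∀ k, i + k < j → g (i+1) - g i + lam * k ≤ g (i + k + 1) - g (i + k) := by
      intro k
      induction k with
      | zero => intro _; simp
      | succ k ih =>
        intro hk
        have e1 := ih (by omega)
        have e2 := hinc (i + k) (by omega)
        rw [show i + (k+1) + 1 = i + k + 2 by ring, show i + (k + 1) = i + k + 1 by ring]
        push_cast
        linarith
    have c3 := c2 (j - i - 1) (by omega)
    have c4 := hj1 (i + (j - i - 1)) (by omega)
    have c5 := hi2 i le_rfl (by omega)
    have c6 : lam * ((j - i - 1 : ℕ) : ℝ) ≤ 2 * δ := by linarith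
    have c7 : ((j - i : ℕ) : ℝ) = ((j - i - 1 : ℕ) : ℝ) + 1 := by
      have : j - i = j - i - 1 + 1 := by omega
      exact_mod_cast this
    rw [c7]
    have : ((j - i - 1 : ℕ) : ℝ) ≤ 2 * δ / lam := by
      rw [le_div_iff₀ hl]; linarith
    linarith
  rw [hsum]
  have := norm_add₃_le (a := ∑ n ∈ Finset.range i, ee (g n)) (b := ∑ n ∈ Finset.Ico i j, ee (g n))
    (c := ∑ n ∈ Finset.range (P - j), ee (g (j + n)))
  have e : (20:ℝ) / δ = 10 / δ + 10 / δ := by ring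
  linarith

lemma chunk (g : ℕ → ℝ) (lam C : ℝ) (hl : 0 < lam) (hl1 : lam ≤ 1) (P : ℕ)
    (hinc : ∀ n < P, lam ≤ g (n+2) - 2 * g (n+1) + g n ∧ g (n+2) - 2 * g (n+1) + g n ≤ C * lam)
    (hP : C * lam * P ≤ 1 / 4) :
    ‖∑ n ∈ Finset.range P, ee (g n)‖ ≤ 23 / √lam := by
  set k : ℤ := round (g 1 - g 0) with hk
  set G : ℕ → ℝ := fun n => g n - k * n with hG
  have hsum : ∑ n ∈ Finset.range P, ee (g n) = ∑ n ∈ Finset.range P, ee (G n) := by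
    apply Finset.sum_congr rfl
    intro n _
    have : G n = g n + ((-(k * n) : ℤ) : ℝ) := by simp only [hG]; push_cast; ring
    rw [this, ee_add_int]
  have hs : 0 < √lam := Real.sqrt_pos.mpr hl
  have hs2 : √lam * √lam = lam := Real.mul_self_sqrt hl.le
  have hdd : ∀ n < P, G (n+2) - 2 * G (n+1) + G n = g (n+2) - 2 * g (n+1) + g n := by
    intro n _; simp only [hG]; push_cast; ring
  have h0 : |G 1 - G 0| ≤ 1 / 2 := by
    have := abs_sub_round (g 1 - g 0)
    rw [← hk] at this
    have e : G 1 - G 0 = g 1 - g 0 - k := by simp [hG]; ring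
    rw [e]; exact this
  have hd : ∀ n ≤ P, G 1 - G 0 ≤ G (n+1) - G n ∧ G (n+1) - G n ≤ G 1 - G 0 + C * lam * n := by
    intro n
    induction n with
    | zero => intro _; simp
    | succ n ih =>
      intro hn
      have e1 := ih (by omega)
      have e2 := hinc n (by omega)
      rw [← hdd n (by omega)] at e2
      rw [show n + 1 + 1 = n + 2 by ring]
      push_cast
      constructor <;> linarith
  have h := chunk0 G lam (√lam) hl hs P (fun n hn => by rw [hdd n hn]; exact (hinc n hn).1) (by
    intro n hn
    have e := hd n hn.le
    have hC : 0 < C * lam := by linarith [hinc n hn]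
    have : C * lam * n ≤ C * lam * P := by gcongr
    rw [abs_le] at h0 ⊢
    constructor <;> linarith)
  rw [hsum]
  refine h.trans ?_
  have e1 : 2 * √lam / lam = 2 / √lam := by
    rw [← hs2]; field_simp
    rw [Real.sqrt_sq hs.le]
  have e2 : (1:ℝ) ≤ 1 / √lam := by
    rw [le_div_iff₀ hs]; rw [one_mul]; exact Real.sqrt_le_one.mpr hl1
  rw [e1]
  have e3 : (23:ℝ) / √lam = 20 / √lam + 2 / √lam + 1 / √lam := by ring
  linarith

lemma chunks (g : ℕ → ℝ) (P : ℕ) (hP : 0 < P) (B : ℝ) (L : ℕ)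
    (hB : ∀ a b, a + b ≤ L → b ≤ P → ‖∑ n ∈ Finset.range b, ee (g (a + n))‖ ≤ B) :
    ‖∑ n ∈ Finset.range L, ee (g n)‖ ≤ ((L:ℝ) / P + 1) * B := by
  have hP' : (0:ℝ) < P := by exact_mod_cast hP
  have hB0 : 0 ≤ B := (norm_nonneg _).trans (hB 0 0 (by omega) (by omega))
  have key : ∀ k a, a ≤ L → L - a ≤ k * P →
      ‖∑ n ∈ Finset.range (L - a), ee (g (a + n))‖ ≤ (((L - a : ℕ):ℝ) / P + 1) * B := by
    intro k
    induction k with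
    | zero =>
      intro a ha h
      have : L - a = 0 := by omega
      rw [this]; simp [hB0]
    | succ k ih =>
      intro a ha h
      rcases le_or_gt (L - a) P with h1 | h1
      · refine (hB a (L - a) (by omega) h1).trans ?_
        have : 0 ≤ (((L - a : ℕ):ℝ) / P) := by positivity
        nlinarith
      · have e := ih (a + P) (by omega) (by rw [add_mul] at h; omega)
        have e2 := hB a P (by omega) le_rfl
        have hs : ∑ n ∈ Finset.range (L - a), ee (g (a + n)) = ∑ n ∈ Finset.range P, ee (g (a + n)) +
            ∑ n ∈ Finset.range (L - (a + P)), ee (g (a + P + n)) := by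
          rw [show L - a = P + (L - (a + P)) by omega, Finset.sum_range_add]
          simp only [add_assoc]
        rw [hs]
        refine (norm_add_le _ _).trans ?_
        have e3 : ((L - a : ℕ):ℝ) = P + ((L - (a + P) : ℕ):ℝ) := by
          have : L - a = P + (L - (a + P)) := by omega
          exact_mod_cast this
        rw [e3, add_div, div_self hP'.ne']
        nlinarith
  have := key L 0 (by omega) (by simpa using Nat.le_mul_of_pos_right L hP)
  simpa using this

theorem test2 (C : ℝ) (hC : 1 ≤ C) (lam : ℝ) (hl : 0 < lam) (g : ℕ → ℝ) (L : ℕ)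
    (h : ∀ n < L, lam ≤ g (n+2) - 2 * g (n+1) + g n ∧ g (n+2) - 2 * g (n+1) + g n ≤ C * lam) :
    ‖∑ n ∈ Finset.range L, ee (g n)‖ ≤ 200 * C * (L * √lam + 1 / √lam) := by
  have hs : 0 < √lam := Real.sqrt_pos.mpr hl
  have hs2 : √lam * √lam = lam := Real.mul_self_sqrt hl.le
  rcases le_or_gt (4 * C * lam) 1 with h1 | h1
  · have hCl : 0 < 4 * C * lam := by positivity
    set P := ⌊1 / (4 * C * lam)⌋₊ with hP
    have hP1 : 1 ≤ P := by
      rw [hP, Nat.one_le_floor_iff, le_div_iff₀ hCl]; linarith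
    have hPu : (P:ℝ) ≤ 1 / (4 * C * lam) := Nat.floor_le (by positivity)
    have hPl : 1 / (4 * C * lam) < P + 1 := Nat.lt_floor_add_one _
    have hP1' : (1:ℝ) ≤ P := by exact_mod_cast hP1
    have hPl2 : 1 / (P:ℝ) ≤ 8 * C * lam := by
      rw [div_le_iff₀ (by linarith)]
      rw [div_lt_iff₀ hCl] at hPl
      nlinarith
    rw [le_div_iff₀ hCl] at hPu
    have := chunks g P hP1 (23 / √lam) L (by
      intro a b hab hb
      apply chunk (fun n => g (a + n)) lam C hl (by nlinarith) b
      · intro n hn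
        exact h (a + n) (by omega)
      · have : (b:ℝ) ≤ P := by exact_mod_cast hb
        have : C * lam * b ≤ C * lam * P := by gcongr
        linarith)
    refine this.trans ?_
    have e1 : (L:ℝ) / P ≤ L * (8 * C * lam) := by
      rw [div_eq_mul_one_div]; gcongr
    calc ((L:ℝ) / P + 1) * (23 / √lam) ≤ (L * (8 * C * lam) + C) * (23 / √lam) := by gcongr
      _ = 184 * C * (L * √lam) + 23 * C * (1 / √lam) := by
          rw [← hs2]; field_simp; rw [Real.sqrt_sq hs.le]; ring
      _ ≤ _ := by
          have : 0 ≤ C * (L * √lam) := by positivity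
          have : 0 ≤ C * (1 / √lam) := by positivity
          linarith
  · have e : ‖∑ n ∈ Finset.range L, ee (g n)‖ ≤ L := by
      refine (norm_sum_le _ _).trans ?_
      simp [norm_ee]
    refine e.trans ?_
    have : 1 ≤ 2 * C * √lam := by
      by_contra hlt
      push Not at hlt
      have h0 : 0 < 2 * C * √lam := by positivity
      nlinarith
    have h2 : (L:ℝ) ≤ L * (2 * C * √lam) := le_mul_of_one_le_right (by positivity) this
    have h3 : 0 ≤ C * (1 / √lam) := by positivity
    have h4 : 0 ≤ L * (C * √lam) := by positivity
    nlinarith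


lemma cs_complex {ι : Type*} (s : Finset ι) (f : ι → ℂ) :
    ‖∑ i ∈ s, f i‖ ^ 2 ≤ s.card * ∑ i ∈ s, ‖f i‖ ^ 2 := by
  have h1 : ‖∑ i ∈ s, f i‖ ≤ ∑ i ∈ s, ‖f i‖ := norm_sum_le _ _
  calc _ ≤ (∑ i ∈ s, ‖f i‖) ^ 2 := by gcongr
    _ ≤ _ := sq_sum_le_card_mul_sum_sq

lemma sum_absdiff (b : ℕ → ℝ) (hb : ∀ n, 0 ≤ b n) (Q q : ℕ) (hq : q < Q) :
    ∑ q' ∈ Finset.range Q, b (max q q' - min q q') ≤ b 0 + 2 * ∑ r ∈ Finset.Ico 1 Q, b r := by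
  rw [Finset.range_eq_Ico, ← Finset.sum_Ico_consecutive _ (Nat.zero_le q) hq.le,
    Finset.sum_eq_sum_Ico_succ_bot hq]
  have h1 : ∑ q' ∈ Finset.Ico 0 q, b (max q q' - min q q') ≤ ∑ r ∈ Finset.Ico 1 Q, b r := by
    have : ∑ q' ∈ Finset.Ico 0 q, b (max q q' - min q q') = ∑ r ∈ Finset.Ico 1 (q+1), b r := by
      refine Finset.sum_bij' (fun x _ => q - x) (fun x _ => q - x) ?_ ?_ ?_ ?_ ?_
      · intro a ha; simp only [Finset.mem_Ico] at ha ⊢; omega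
      · intro a ha; simp only [Finset.mem_Ico] at ha ⊢; omega
      · intro a ha; simp only [Finset.mem_Ico] at ha ⊢; omega
      · intro a ha; simp only [Finset.mem_Ico] at ha ⊢; omega
      · intro a ha; simp only [Finset.mem_Ico] at ha; congr 1; omega
    rw [this]
    apply Finset.sum_le_sum_of_subset_of_nonneg
    · apply Finset.Ico_subset_Ico_right; omega
    · intros; exact hb _
  have h2 : ∑ q' ∈ Finset.Ico (q+1) Q, b (max q q' - min q q') ≤ ∑ r ∈ Finset.Ico 1 Q, b r := by
    have : ∑ q' ∈ Finset.Ico (q+1) Q, b (max q q' - min q q') = ∑ r ∈ Finset.Ico 1 (Q - q), b r := by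
      refine Finset.sum_bij' (fun x _ => x - q) (fun x _ => x + q) ?_ ?_ ?_ ?_ ?_
      · intro a ha; simp only [Finset.mem_Ico] at ha ⊢; omega
      · intro a ha; simp only [Finset.mem_Ico] at ha ⊢; omega
      · intro a ha; simp only [Finset.mem_Ico] at ha ⊢; omega
      · intro a ha; simp only [Finset.mem_Ico] at ha ⊢; omega
      · intro a ha; simp only [Finset.mem_Ico] at ha; congr 1; omega
    rw [this]
    apply Finset.sum_le_sum_of_subset_of_nonneg
    · apply Finset.Ico_subset_Ico_right; omega
    · intros; exact hb _
  have h3 : max q q - min q q = 0 := by simp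
  rw [h3]
  linarith

noncomputable def cor (z : ℕ → ℂ) (L r : ℕ) : ℂ :=
  ∑ n ∈ Finset.range (L - r), z (n + r) * (starRingEnd ℂ) (z n)

noncomputable def zt (z : ℕ → ℂ) (L k q : ℕ) : ℂ := if q ≤ k ∧ k - q < L then z (k - q) else 0

lemma zt_corr (z : ℕ → ℂ) (L Q q q' : ℕ) (hq' : q' < Q) (h : q ≤ q') :
    ∑ k ∈ Finset.range (L + Q), zt z L k q * (starRingEnd ℂ) (zt z L k q') = cor z L (q' - q) := by
  unfold cor
  have h1 : ∀ k ∈ Finset.range (L + Q), zt z L k q * (starRingEnd ℂ) (zt z L k q') =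
      if q' ≤ k ∧ k - q < L then z (k - q) * (starRingEnd ℂ) (z (k - q')) else 0 := by
    intro k _
    unfold zt
    by_cases h1 : q' ≤ k ∧ k - q < L
    · rw [if_pos h1, if_pos (by omega), if_pos (by omega)]
    · rw [if_neg h1]
      by_cases h2 : q ≤ k ∧ k - q < L
      · rw [if_neg (show ¬ (q' ≤ k ∧ k - q' < L) by omega)]; simp
      · rw [if_neg h2]; simp
  rw [Finset.sum_congr rfl h1, ← Finset.sum_filter]
  refine Finset.sum_bij' (fun x _ => x - q') (fun x _ => x + q') ?_ ?_ ?_ ?_ ?_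
  · intro a ha; simp only [Finset.mem_filter, Finset.mem_range] at ha ⊢; omega
  · intro a ha; simp only [Finset.mem_filter, Finset.mem_range] at ha ⊢; omega
  · intro a ha; simp only [Finset.mem_filter, Finset.mem_range] at ha ⊢; omega
  · intro a ha; simp only [Finset.mem_filter, Finset.mem_range] at ha ⊢; omega
  · intro a ha; simp only [Finset.mem_filter, Finset.mem_range] at ha
    congr 2
    omega

lemma zt_sum (z : ℕ → ℂ) (L Q q : ℕ) (hq : q < Q) :
    ∑ k ∈ Finset.range (L + Q), zt z L k q = ∑ n ∈ Finset.range L, z n := by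
  unfold zt
  rw [← Finset.sum_filter]
  refine Finset.sum_bij' (fun x _ => x - q) (fun x _ => x + q) ?_ ?_ ?_ ?_ ?_
  · intro a ha; simp only [Finset.mem_filter, Finset.mem_range] at ha ⊢; omega
  · intro a ha; simp only [Finset.mem_filter, Finset.mem_range] at ha ⊢; omega
  · intro a ha; simp only [Finset.mem_filter, Finset.mem_range] at ha ⊢; omega
  · intro a ha; simp only [Finset.mem_filter, Finset.mem_range] at ha ⊢; omega
  · intro a ha; rfl

lemma weyl (z : ℕ → ℂ) (hz : ∀ n, ‖z n‖ ≤ 1) (L Q : ℕ) (hQ : 1 ≤ Q) (hQL : Q ≤ L) :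
    ‖∑ n ∈ Finset.range L, z n‖ ^ 2 ≤ 2 * (L:ℝ) ^ 2 / Q +
      4 * L / Q * ∑ r ∈ Finset.Ico 1 Q, ‖cor z L r‖ := by
  set S := ∑ n ∈ Finset.range L, z n with hS
  have hQ0 : (0:ℝ) < Q := by exact_mod_cast hQ
  have hQL' : (Q:ℝ) ≤ L := by exact_mod_cast hQL
  have h1 : (Q:ℂ) * S = ∑ k ∈ Finset.range (L + Q), ∑ q ∈ Finset.range Q, zt z L k q := by
    rw [Finset.sum_comm, Finset.sum_congr rfl (fun q hq => zt_sum z L Q q (Finset.mem_range.mp hq))]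
    simp [hS]
  have hcor : ∀ q ∈ Finset.range Q, ∀ q' ∈ Finset.range Q,
      ‖∑ k ∈ Finset.range (L + Q), zt z L k q * (starRingEnd ℂ) (zt z L k q')‖ =
        ‖cor z L (max q q' - min q q')‖ := by
    intro q hq q' hq'
    rw [Finset.mem_range] at hq hq'
    rcases le_total q q' with h | h
    · rw [zt_corr z L Q q q' hq' h, max_eq_right h, min_eq_left h]
    · rw [max_eq_left h, min_eq_right h, ← zt_corr z L Q q' q hq h, ← Complex.norm_conj]
      congr 1
      rw [map_sum]
      apply Finset.sum_congr rfl
      intro k _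
      rw [map_mul, Complex.conj_conj, mul_comm]
  have h2 : ∑ k ∈ Finset.range (L + Q), ‖∑ q ∈ Finset.range Q, zt z L k q‖ ^ 2 ≤
      Q * (L + 2 * ∑ r ∈ Finset.Ico 1 Q, ‖cor z L r‖) := by
    have e1 : ((∑ k ∈ Finset.range (L + Q), ‖∑ q ∈ Finset.range Q, zt z L k q‖ ^ 2 : ℝ) : ℂ) =
        ∑ q ∈ Finset.range Q, ∑ q' ∈ Finset.range Q,
          ∑ k ∈ Finset.range (L + Q), zt z L k q * (starRingEnd ℂ) (zt z L k q') := by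
      push_cast
      have : ∀ q ∈ Finset.range Q, ∑ q' ∈ Finset.range Q,
          ∑ k ∈ Finset.range (L + Q), zt z L k q * (starRingEnd ℂ) (zt z L k q') =
          ∑ k ∈ Finset.range (L + Q), ∑ q' ∈ Finset.range Q,
          zt z L k q * (starRingEnd ℂ) (zt z L k q') := fun q _ => Finset.sum_comm
      rw [Finset.sum_congr rfl this, Finset.sum_comm]
      apply Finset.sum_congr rfl
      intro k _
      rw [← Complex.mul_conj', map_sum, Finset.sum_mul_sum]
    have e2 : ∑ k ∈ Finset.range (L + Q), ‖∑ q ∈ Finset.range Q, zt z L k q‖ ^ 2 =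
        ‖((∑ k ∈ Finset.range (L + Q), ‖∑ q ∈ Finset.range Q, zt z L k q‖ ^ 2 : ℝ) : ℂ)‖ := by
      rw [Complex.norm_real, Real.norm_of_nonneg]
      positivity
    rw [e2, e1]
    have c0 : ‖cor z L 0‖ ≤ L := by
      unfold cor
      refine (norm_sum_le _ _).trans ?_
      have : ∀ n ∈ Finset.range (L - 0), ‖z (n + 0) * (starRingEnd ℂ) (z n)‖ ≤ 1 := by
        intro n _
        rw [norm_mul, Complex.norm_conj]
        exact mul_le_one₀ (hz _) (norm_nonneg _) (hz _)
      refine (Finset.sum_le_sum this).trans ?_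
      simp
    calc _ ≤ ∑ q ∈ Finset.range Q, ∑ q' ∈ Finset.range Q,
          ‖∑ k ∈ Finset.range (L + Q), zt z L k q * (starRingEnd ℂ) (zt z L k q')‖ :=
          (norm_sum_le _ _).trans (Finset.sum_le_sum fun q _ => norm_sum_le _ _)
      _ = ∑ q ∈ Finset.range Q, ∑ q' ∈ Finset.range Q, ‖cor z L (max q q' - min q q')‖ :=
          Finset.sum_congr rfl fun q hq => Finset.sum_congr rfl fun q' hq' => hcor q hq q' hq'
      _ ≤ ∑ q ∈ Finset.range Q, (‖cor z L 0‖ + 2 * ∑ r ∈ Finset.Ico 1 Q, ‖cor z L r‖) :=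
          Finset.sum_le_sum fun q hq => sum_absdiff (fun r => ‖cor z L r‖) (fun _ => norm_nonneg _)
            Q q (Finset.mem_range.mp hq)
      _ = Q * (‖cor z L 0‖ + 2 * ∑ r ∈ Finset.Ico 1 Q, ‖cor z L r‖) := by
          rw [Finset.sum_const, Finset.card_range, nsmul_eq_mul]
      _ ≤ _ := by gcongr
  have h3 := cs_complex (Finset.range (L + Q)) (fun k => ∑ q ∈ Finset.range Q, zt z L k q)
  rw [← h1, norm_mul, Complex.norm_natCast, Finset.card_range, mul_pow] at h3
  have h4 : (Q:ℝ) ^ 2 * ‖S‖ ^ 2 ≤ (2 * L) * (Q * (L + 2 * ∑ r ∈ Finset.Ico 1 Q, ‖cor z L r‖)) := by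
    refine h3.trans ?_
    push_cast
    have : 0 ≤ ∑ r ∈ Finset.Ico 1 Q, ‖cor z L r‖ := by positivity
    apply mul_le_mul _ h2 (by positivity) (by positivity)
    linarith
  have h5 : 2 * (L:ℝ) ^ 2 / Q + 4 * L / Q * ∑ r ∈ Finset.Ico 1 Q, ‖cor z L r‖ =
      ((2 * L) * (Q * (L + 2 * ∑ r ∈ Finset.Ico 1 Q, ‖cor z L r‖))) / (Q:ℝ) ^ 2 := by
    field_simp; ring
  rw [h5, le_div_iff₀ (by positivity)]
  linarith

lemma cor_ee (g : ℕ → ℝ) (L r : ℕ) :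
    cor (fun n => ee (g n)) L r = ∑ n ∈ Finset.range (L - r), ee (g (n + r) - g n) := by
  unfold cor
  apply Finset.sum_congr rfl
  intro n _
  rw [ee_sub]

lemma sum_inv_sqrt' (Q : ℕ) : ∑ r ∈ Finset.Ico 1 (Q+1), 1 / √(r:ℝ) ≤ 2 * √(Q:ℝ) := by
  induction Q with
  | zero => simp
  | succ Q ih =>
    rw [Finset.sum_Ico_succ_top (by omega)]
    have hq : (0:ℝ) ≤ Q := by positivity
    have h2 : √(Q:ℝ) * √(Q:ℝ) = Q := Real.mul_self_sqrt hq
    have h3 : √((Q:ℝ)+1) * √((Q:ℝ)+1) = Q + 1 := Real.mul_self_sqrt (by positivity)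
    have h1 : 0 < √((Q:ℝ)+1) := Real.sqrt_pos.mpr (by positivity)
    push_cast
    have : 1 / √((Q:ℝ)+1) ≤ 2 * √((Q:ℝ)+1) - 2 * √(Q:ℝ) := by
      rw [div_le_iff₀ h1]
      nlinarith [sq_nonneg (√((Q:ℝ)+1) - √(Q:ℝ))]
    linarith

lemma sum_inv_sqrt (Q : ℕ) : ∑ r ∈ Finset.Ico 1 Q, 1 / √(r:ℝ) ≤ 2 * √(Q:ℝ) := by
  refine le_trans ?_ (sum_inv_sqrt' Q)
  apply Finset.sum_le_sum_of_subset_of_nonneg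
  · apply Finset.Ico_subset_Ico_right; omega
  · intros; positivity

/-- sum of shifted differences -/
lemma shift_diff (F : ℕ → ℝ) (r n : ℕ) : F (n + r) - F n = ∑ i ∈ Finset.range r, (F (n+i+1) - F (n+i)) := by
  induction r with
  | zero => simp
  | succ r ih => rw [Finset.sum_range_succ, ← ih, ← add_assoc]; ring

lemma shift_bound (F : ℕ → ℝ) (lam C : ℝ) (L r n : ℕ) (hn : n < L - r)
    (h : ∀ n < L, lam ≤ F (n+1) - F n ∧ F (n+1) - F n ≤ C * lam) :
    r * lam ≤ F (n + r) - F n ∧ F (n + r) - F n ≤ C * (r * lam) := by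
  rw [shift_diff]
  constructor
  · have := Finset.card_nsmul_le_sum (Finset.range r) (fun i => F (n+i+1) - F (n+i)) lam
      (fun i hi => (h (n+i) (by rw [Finset.mem_range] at hi; omega)).1)
    simpa using this
  · have := Finset.sum_le_card_nsmul (Finset.range r) (fun i => F (n+i+1) - F (n+i)) (C * lam)
      (fun i hi => (h (n+i) (by rw [Finset.mem_range] at hi; omega)).2)
    simp only [Finset.card_range, nsmul_eq_mul] at this
    linarith

def D3 (g : ℕ → ℝ) (n : ℕ) : ℝ := g (n+3) - 3 * g (n+2) + 3 * g (n+1) - g n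
def D4 (g : ℕ → ℝ) (n : ℕ) : ℝ := g (n+4) - 4 * g (n+3) + 6 * g (n+2) - 4 * g (n+1) + g n

lemma sum_triv (g : ℕ → ℝ) (L : ℕ) : ‖∑ n ∈ Finset.range L, ee (g n)‖ ≤ L := by
  refine (norm_sum_le _ _).trans ?_
  simp [norm_ee]

lemma floor_facts {μ : ℝ} (h0 : 0 < μ) (h1 : μ ≤ 1) :
    1 ≤ ⌊1 / μ ^ 2⌋₊ ∧ (⌊1 / μ ^ 2⌋₊ : ℝ) * μ ^ 2 ≤ 1 ∧ 1 / (⌊1 / μ ^ 2⌋₊ : ℝ) ≤ 2 * μ ^ 2 ∧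
    √(⌊1 / μ ^ 2⌋₊ : ℝ) * μ ≤ 1 ∧ 1 / √(⌊1 / μ ^ 2⌋₊ : ℝ) ≤ 2 * μ := by
  have hm : 0 < μ ^ 2 := by positivity
  have hm1 : μ ^ 2 ≤ 1 := by nlinarith
  set Q := ⌊1 / μ ^ 2⌋₊ with hQ
  have a : 1 ≤ Q := by rw [hQ, Nat.one_le_floor_iff, le_div_iff₀ hm]; linarith
  have a' : (1:ℝ) ≤ Q := by exact_mod_cast a
  have b : (Q:ℝ) ≤ 1 / μ ^ 2 := Nat.floor_le (by positivity)
  have c : 1 / μ ^ 2 < Q + 1 := Nat.lt_floor_add_one _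
  rw [le_div_iff₀ hm] at b
  rw [div_lt_iff₀ hm] at c
  have hs : 0 < √(Q:ℝ) := Real.sqrt_pos.mpr (by linarith)
  have hs2 : √(Q:ℝ) * √(Q:ℝ) = Q := Real.mul_self_sqrt (by linarith)
  refine ⟨a, b, ?_, ?_, ?_⟩
  · rw [div_le_iff₀ (by linarith)]; nlinarith
  · by_contra h; push Not at h
    have : 0 < √(Q:ℝ) * μ := by positivity
    nlinarith
  · rw [div_le_iff₀ hs]
    by_contra h; push Not at h
    have : 0 < √(Q:ℝ) * μ := by positivity
    nlinarith

theorem test3 (C : ℝ) (hC : 1 ≤ C) : ∃ A : ℝ, 1 ≤ A ∧ ∀ (μ : ℝ) (_ : 0 < μ) (g : ℕ → ℝ) (L : ℕ)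
    (_ : ∀ n < L, μ ^ 6 ≤ D3 g n ∧ D3 g n ≤ C * μ ^ 6),
    ‖∑ n ∈ Finset.range L, ee (g n)‖ ≤ A * (L * μ + √L / μ) := by
  refine ⟨20000 * C, by linarith, ?_⟩
  intro μ hμ g L h
  have hL0 : (0:ℝ) ≤ L := by positivity
  have hLs : √(L:ℝ) * √(L:ℝ) = L := Real.mul_self_sqrt hL0
  have hLs0 : 0 ≤ √(L:ℝ) := Real.sqrt_nonneg _
  have hbig : 0 ≤ √(L:ℝ) / μ := by positivity
  have hbig2 : 0 ≤ L * μ := by positivity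
  rcases lt_or_ge 1 μ with h1 | h1
  · refine (sum_triv g L).trans ?_
    have : (L:ℝ) ≤ L * μ := le_mul_of_one_le_right hL0 h1.le
    nlinarith
  obtain ⟨f1, f2, f3, f4, f5⟩ := floor_facts hμ h1
  set Q := ⌊1 / μ ^ 2⌋₊ with hQ
  rcases lt_or_ge L Q with h2 | h2
  · refine (sum_triv g L).trans ?_
    have : (L:ℝ) ≤ √(L:ℝ) / μ := by
      rw [le_div_iff₀ hμ]
      have : √(L:ℝ) ≤ √(Q:ℝ) := Real.sqrt_le_sqrt (by exact_mod_cast h2.le)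
      have : √(L:ℝ) * μ ≤ 1 := by nlinarith
      nlinarith
    nlinarith
  have hw := weyl (fun n => ee (g n)) (fun n => (norm_ee _).le) L Q f1 h2
  have hQ1 : (1:ℝ) ≤ Q := by exact_mod_cast f1
  have hc : ∀ r ∈ Finset.Ico 1 Q, ‖cor (fun n => ee (g n)) L r‖ ≤
      200 * C * (L * (√Q * μ ^ 3)) + 200 * C * (1 / μ ^ 3) * (1 / √(r:ℝ)) := by
    intro r hr
    rw [Finset.mem_Ico] at hr
    have hr0 : (0:ℝ) < r := by exact_mod_cast hr.1
    have hr1 : 0 < √(r:ℝ) := Real.sqrt_pos.mpr hr0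
    rw [cor_ee]
    have t := test2 C hC (r * μ ^ 6) (by positivity) (fun n => g (n + r) - g n) (L - r) (by
      intro n hn
      have := shift_bound (fun n => g (n+2) - 2 * g (n+1) + g n) (μ ^ 6) C L r n hn (by
        intro n hn
        have := h n hn
        unfold D3 at this
        constructor <;> nlinarith)
      rw [show n + 2 + r = n + r + 2 by ring, show n + 1 + r = n + r + 1 by ring]
      constructor <;> linarith)
    have e : √(r * μ ^ 6) = √(r:ℝ) * μ ^ 3 := by
      rw [Real.sqrt_mul hr0.le, show μ ^ 6 = (μ ^ 3) ^ 2 by ring, Real.sqrt_sq (by positivity)]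
    rw [e] at t
    refine t.trans ?_
    have e1 : ((L - r : ℕ):ℝ) ≤ L := by exact_mod_cast Nat.sub_le _ _
    have e2 : √(r:ℝ) ≤ √(Q:ℝ) := Real.sqrt_le_sqrt (by exact_mod_cast hr.2.le)
    have e3 : ((L - r : ℕ):ℝ) * (√(r:ℝ) * μ ^ 3) ≤ L * (√Q * μ ^ 3) := by gcongr
    have e4 : 1 / (√(r:ℝ) * μ ^ 3) = (1 / μ ^ 3) * (1 / √(r:ℝ)) := by field_simp
    rw [e4, mul_add, mul_assoc (200 * C) (1 / μ ^ 3)]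
    gcongr
  have hsum : ∑ r ∈ Finset.Ico 1 Q, ‖cor (fun n => ee (g n)) L r‖ ≤
      Q * (200 * C * (L * (√Q * μ ^ 3))) + 200 * C * (1 / μ ^ 3) * (2 * √(Q:ℝ)) := by
    refine (Finset.sum_le_sum hc).trans ?_
    rw [Finset.sum_add_distrib, Finset.sum_const, Nat.card_Ico, nsmul_eq_mul, ← Finset.mul_sum]
    have := sum_inv_sqrt Q
    have hcard : ((Q - 1 : ℕ):ℝ) ≤ Q := by exact_mod_cast Nat.sub_le _ _
    gcongr
  have hfin : ‖∑ n ∈ Finset.range L, ee (g n)‖ ^ 2 ≤ 5000 * C * (L ^ 2 * μ ^ 2 + L / μ ^ 2) := by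
    refine hw.trans ?_
    have hs : 0 < √(Q:ℝ) := Real.sqrt_pos.mpr (by linarith)
    have hs2 : √(Q:ℝ) * √(Q:ℝ) = Q := Real.mul_self_sqrt (by linarith)
    have a1 : 2 * (L:ℝ)^2 / Q ≤ 4 * L ^ 2 * μ ^ 2 := by
      rw [div_eq_mul_one_div]
      calc 2 * (L:ℝ)^2 * (1 / Q) ≤ 2 * (L:ℝ)^2 * (2 * μ ^ 2) := by gcongr
        _ = _ := by ring
    have a2 : 4 * (L:ℝ) / Q * (Q * (200 * C * (L * (√Q * μ ^ 3))) + 200 * C * (1 / μ ^ 3) * (2 * √(Q:ℝ)))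
        = 800 * C * L ^ 2 * μ ^ 2 * (√Q * μ) + 1600 * C * L * (1 / μ ^ 3) * (1 / √Q) := by
      have : √(Q:ℝ) / Q = 1 / √Q := by
        rw [div_eq_div_iff (by linarith) hs.ne']; linarith
      have e : 1600 * C * L * (1 / μ ^ 3) * (1 / √(Q:ℝ)) = 1600 * C * L * (1 / μ ^ 3) * (√(Q:ℝ) / Q) := by
        rw [this]
      rw [e]
      field_simp
      ring
    have a3 : 800 * C * L ^ 2 * μ ^ 2 * (√Q * μ) ≤ 800 * C * L ^ 2 * μ ^ 2 * 1 := by gcongr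
    have a4 : 1600 * C * L * (1 / μ ^ 3) * (1 / √(Q:ℝ)) ≤ 1600 * C * L * (1 / μ ^ 3) * (2 * μ) := by gcongr
    have a5 : 1600 * C * L * (1 / μ ^ 3) * (2 * μ) = 3200 * C * (L / μ ^ 2) := by field_simp; ring
    have a6 : 4 * (L:ℝ) / Q * ∑ r ∈ Finset.Ico 1 Q, ‖cor (fun n => ee (g n)) L r‖ ≤
      4 * (L:ℝ) / Q * (Q * (200 * C * (L * (√Q * μ ^ 3))) + 200 * C * (1 / μ ^ 3) * (2 * √(Q:ℝ))) := by
      gcongr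
    have a7 : 0 ≤ C * (L / μ ^ 2) := by positivity
    have a8 : 0 ≤ (C - 1) * (L ^ 2 * μ ^ 2) := mul_nonneg (by linarith) (by positivity)
    have a9 : 0 ≤ L ^ 2 * μ ^ 2 := by positivity
    nlinarith
  refine (pow_le_pow_iff_left₀ (norm_nonneg _) (by positivity) (two_ne_zero)).mp ?_
  refine hfin.trans ?_
  have b1 : L / μ ^ 2 = (√(L:ℝ) / μ) ^ 2 := by rw [div_pow, Real.sq_sqrt hL0]
  have b2 : (L:ℝ) ^ 2 * μ ^ 2 = (L * μ) ^ 2 := by ring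
  rw [b1, b2]
  set X := L * μ
  set Y := √(L:ℝ) / μ
  have b3 : X ^ 2 + Y ^ 2 ≤ (X + Y) ^ 2 := by nlinarith
  calc 5000 * C * (X ^ 2 + Y ^ 2) ≤ 5000 * C * (X + Y) ^ 2 := by gcongr
    _ ≤ (20000 * C) ^ 2 * (X + Y) ^ 2 := by
      have : 5000 * C ≤ (20000 * C) ^ 2 := by nlinarith only [hC]
      exact mul_le_mul_of_nonneg_right this (sq_nonneg _)
    _ = _ := by ring

set_option maxHeartbeats 1000000 in
theorem test4 (C : ℝ) (hC : 1 ≤ C) : ∃ A : ℝ, 1 ≤ A ∧ ∀ (ρ : ℝ) (_ : 0 < ρ) (g : ℕ → ℝ) (L : ℕ)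
    (_ : ∀ n < L, ρ ^ 14 ≤ D4 g n ∧ D4 g n ≤ C * ρ ^ 14),
    ‖∑ n ∈ Finset.range L, ee (g n)‖ ≤ A * (L * ρ + √(L * √L) / ρ) := by
  obtain ⟨A₃, hA₃, t3⟩ := test3 C hC
  refine ⟨20 * A₃, by linarith, ?_⟩
  intro ρ hρ g L h
  have hL0 : (0:ℝ) ≤ L := by positivity
  have hLs : √(L:ℝ) * √(L:ℝ) = L := Real.mul_self_sqrt hL0
  have hLs0 : 0 ≤ √(L:ℝ) := Real.sqrt_nonneg _
  have hbig : 0 ≤ √(L * √L) / ρ := by positivity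
  have hbig2 : 0 ≤ L * ρ := by positivity
  rcases lt_or_ge 1 ρ with h1 | h1
  · refine (sum_triv g L).trans ?_
    have : (L:ℝ) ≤ L * ρ := le_mul_of_one_le_right hL0 h1.le
    nlinarith
  obtain ⟨f1, f2, f3, f4, f5⟩ := floor_facts hρ h1
  set Q := ⌊1 / ρ ^ 2⌋₊ with hQ
  rcases lt_or_ge L Q with h2 | h2
  · refine (sum_triv g L).trans ?_
    have : (L:ℝ) ≤ √(L * √L) / ρ := by
      rcases Nat.eq_zero_or_pos L with h0 | h0
      · subst h0; simp
      have hL1 : (1:ℝ) ≤ L := by exact_mod_cast h0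
      have hs1 : 1 ≤ √(L:ℝ) := Real.one_le_sqrt.mpr hL1
      have : √(L:ℝ) ≤ √(L * √L) := Real.sqrt_le_sqrt (by nlinarith)
      rw [le_div_iff₀ hρ]
      have : √(L:ℝ) ≤ √(Q:ℝ) := Real.sqrt_le_sqrt (by exact_mod_cast h2.le)
      have : √(L:ℝ) * ρ ≤ 1 := by nlinarith
      nlinarith
    nlinarith
  have hw := weyl (fun n => ee (g n)) (fun n => (norm_ee _).le) L Q f1 h2
  have hQ1 : (1:ℝ) ≤ Q := by exact_mod_cast f1
  have hc : ∀ r ∈ Finset.Ico 1 Q, ‖cor (fun n => ee (g n)) L r‖ ≤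
      A₃ * (L * ρ ^ 2) + A₃ * (√L / ρ ^ 3) * (1 / √(r:ℝ)) := by
    intro r hr
    rw [Finset.mem_Ico] at hr
    have hr0 : (0:ℝ) < r := by exact_mod_cast hr.1
    have hr1 : 0 < √(r:ℝ) := Real.sqrt_pos.mpr hr0
    have hrQ : (r:ℝ) ≤ Q := by exact_mod_cast hr.2.le
    have hrρ : r * ρ ^ 2 ≤ 1 := by nlinarith [sq_nonneg ρ]
    rw [cor_ee]
    set μ := (r * ρ ^ 14) ^ ((1:ℝ)/6) with hμ
    have hμ0 : 0 < μ := by positivity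
    have hμ6 : μ ^ 6 = r * ρ ^ 14 := by
      rw [hμ, ← Real.rpow_natCast, ← Real.rpow_mul (by positivity)]; norm_num
    have hμu : μ ≤ ρ ^ 2 := by
      refine (pow_le_pow_iff_left₀ hμ0.le (by positivity) (show 6 ≠ 0 by norm_num)).mp ?_
      rw [hμ6]
      calc r * ρ ^ 14 = (r * ρ ^ 2) * ρ ^ 12 := by ring
        _ ≤ 1 * ρ ^ 12 := by gcongr
        _ = _ := by ring
    have hμl : √(r:ℝ) * ρ ^ 3 ≤ μ := by
      refine (pow_le_pow_iff_left₀ (by positivity) hμ0.le (show 6 ≠ 0 by norm_num)).mp ?_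
      rw [hμ6, mul_pow, show √(r:ℝ) ^ 6 = (√(r:ℝ) ^ 2) ^ 3 by ring, Real.sq_sqrt hr0.le]
      calc (r:ℝ) ^ 3 * (ρ ^ 3) ^ 6 = (r * ρ ^ 2) ^ 2 * (r * ρ ^ 14) := by ring
        _ ≤ 1 ^ 2 * (r * ρ ^ 14) := by gcongr
        _ = _ := by ring
    have t := t3 μ hμ0 (fun n => g (n + r) - g n) (L - r) (by
      intro n hn
      have := shift_bound (fun n => D3 g n) (ρ ^ 14) C L r n hn (by
        intro n hn
        have := h n hn
        unfold D4 at this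
        unfold D3
        rw [show n + 1 + 3 = n + 4 by ring, show n + 1 + 2 = n + 3 by ring,
          show n + 1 + 1 = n + 2 by ring]
        constructor <;> nlinarith)
      rw [hμ6]
      unfold D3 at this ⊢
      beta_reduce at this ⊢
      rw [show n + 3 + r = n + r + 3 by ring, show n + 2 + r = n + r + 2 by ring,
        show n + 1 + r = n + r + 1 by ring]
      constructor <;> linarith)
    refine t.trans ?_
    have e1 : ((L - r : ℕ):ℝ) ≤ L := by exact_mod_cast Nat.sub_le _ _
    have e3 : ((L - r : ℕ):ℝ) * μ ≤ L * ρ ^ 2 := by gcongr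
    have e4 : √((L - r : ℕ):ℝ) / μ ≤ √(L:ℝ) / (√(r:ℝ) * ρ ^ 3) := by gcongr
    have e5 : √(L:ℝ) / (√(r:ℝ) * ρ ^ 3) = √L / ρ ^ 3 * (1 / √(r:ℝ)) := by field_simp
    rw [e5] at e4
    rw [mul_add, mul_assoc A₃ (√L / ρ ^ 3)]
    gcongr
  have hsum : ∑ r ∈ Finset.Ico 1 Q, ‖cor (fun n => ee (g n)) L r‖ ≤
      Q * (A₃ * (L * ρ ^ 2)) + A₃ * (√L / ρ ^ 3) * (2 * √(Q:ℝ)) := by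
    refine (Finset.sum_le_sum hc).trans ?_
    rw [Finset.sum_add_distrib, Finset.sum_const, Nat.card_Ico, nsmul_eq_mul, ← Finset.mul_sum]
    have := sum_inv_sqrt Q
    have hcard : ((Q - 1 : ℕ):ℝ) ≤ Q := by exact_mod_cast Nat.sub_le _ _
    gcongr
  have hfin : ‖∑ n ∈ Finset.range L, ee (g n)‖ ^ 2 ≤ 20 * A₃ * (L ^ 2 * ρ ^ 2 + L * √L / ρ ^ 2) := by
    refine hw.trans ?_
    have hs : 0 < √(Q:ℝ) := Real.sqrt_pos.mpr (by linarith)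
    have hs2 : √(Q:ℝ) * √(Q:ℝ) = Q := Real.mul_self_sqrt (by linarith)
    have a1 : 2 * (L:ℝ)^2 / Q ≤ 4 * L ^ 2 * ρ ^ 2 := by
      rw [div_eq_mul_one_div]
      calc 2 * (L:ℝ)^2 * (1 / Q) ≤ 2 * (L:ℝ)^2 * (2 * ρ ^ 2) := by gcongr
        _ = _ := by ring
    have a2 : 4 * (L:ℝ) / Q * (Q * (A₃ * (L * ρ ^ 2)) + A₃ * (√L / ρ ^ 3) * (2 * √(Q:ℝ)))
        = 4 * A₃ * L ^ 2 * ρ ^ 2 + 8 * A₃ * L * (√L / ρ ^ 3) * (1 / √Q) := by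
      have : √(Q:ℝ) / Q = 1 / √Q := by
        rw [div_eq_div_iff (by linarith) hs.ne']; linarith
      rw [← this]
      field_simp
      ring
    have a4 : 8 * A₃ * L * (√L / ρ ^ 3) * (1 / √(Q:ℝ)) ≤ 8 * A₃ * L * (√L / ρ ^ 3) * (2 * ρ) := by gcongr
    have a5 : 8 * A₃ * L * (√L / ρ ^ 3) * (2 * ρ) = 16 * A₃ * (L * √L / ρ ^ 2) := by field_simp; ring
    have a6 : 4 * (L:ℝ) / Q * ∑ r ∈ Finset.Ico 1 Q, ‖cor (fun n => ee (g n)) L r‖ ≤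
      4 * (L:ℝ) / Q * (Q * (A₃ * (L * ρ ^ 2)) + A₃ * (√L / ρ ^ 3) * (2 * √(Q:ℝ))) := by
      gcongr
    have a7 : 0 ≤ A₃ * (L * √L / ρ ^ 2) := by positivity
    have a8 : 0 ≤ (A₃ - 1) * (L ^ 2 * ρ ^ 2) := mul_nonneg (by linarith) (by positivity)
    have a9 : 0 ≤ L ^ 2 * ρ ^ 2 := by positivity
    nlinarith
  refine (pow_le_pow_iff_left₀ (norm_nonneg _) (by positivity) (two_ne_zero)).mp ?_
  refine hfin.trans ?_
  have b1 : L * √L / ρ ^ 2 = (√(L * √L) / ρ) ^ 2 := by rw [div_pow, Real.sq_sqrt (by positivity)]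
  have b2 : (L:ℝ) ^ 2 * ρ ^ 2 = (L * ρ) ^ 2 := by ring
  rw [b1, b2]
  set X := L * ρ
  set Y := √(L * √L) / ρ
  have b3 : X ^ 2 + Y ^ 2 ≤ (X + Y) ^ 2 := by nlinarith
  calc 20 * A₃ * (X ^ 2 + Y ^ 2) ≤ 20 * A₃ * (X + Y) ^ 2 := by gcongr
    _ ≤ (20 * A₃) ^ 2 * (X + Y) ^ 2 := by
      have : 20 * A₃ ≤ (20 * A₃) ^ 2 := by nlinarith only [hA₃]
      exact mul_le_mul_of_nonneg_right this (sq_nonneg _)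
    _ = _ := by ring


theorem hasDerivAt_ee {g : ℝ → ℝ} {g' x : ℝ} (h : HasDerivAt g g' x) :
    HasDerivAt (fun x => ee (g x)) (((2 * π * g' : ℝ) : ℂ) * Complex.I * ee (g x)) x := by
  unfold ee
  have h1 : HasDerivAt (fun x => ((2 * π * g x : ℝ) : ℂ)) ((2 * π * g' : ℝ) : ℂ) x :=
    (h.const_mul (2 * π)).ofReal_comp
  have h2 := (h1.mul_const Complex.I).cexp
  convert h2 using 1
  ring

theorem continuous_ee : Continuous ee := by unfold ee; fun_prop

/-- first derivative test for integrals -/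
theorem fdt {a b μ : ℝ} (hab : a ≤ b) (hμ : 0 < μ) {g g1 g2 : ℝ → ℝ}
    (h0 : ∀ x ∈ Set.Icc a b, HasDerivAt g (g1 x) x)
    (h1 : ∀ x ∈ Set.Icc a b, HasDerivAt g1 (g2 x) x)
    (h2 : ∀ x ∈ Set.Icc a b, 0 ≤ g2 x)
    (hne : ∀ x ∈ Set.Icc a b, g1 x ≠ 0) (ha : μ ≤ |g1 a|) (hb : μ ≤ |g1 b|) :
    ‖∫ x in a..b, ee (g x)‖ ≤ 1 / μ := by
  have hπ : (0:ℝ) < π := Real.pi_pos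
  have hcg : ContinuousOn (fun x => ee (g x)) (Set.Icc a b) :=
    continuous_ee.comp_continuousOn (fun x hx => (h0 x hx).continuousAt.continuousWithinAt)
  set Φ : ℝ → ℂ := fun x => ee (g x) * (((2 * π * g1 x : ℝ) : ℂ) * Complex.I)⁻¹ with hΦ
  set H : ℝ → ℂ := fun x => (∫ t in a..x, ee (g t)) - Φ x + Φ a with hH
  have hΦd : ∀ x ∈ Set.Icc a b, HasDerivAt Φ (ee (g x) - ee (g x) * (((2 * π * g1 x : ℝ) : ℂ) * Complex.I)⁻¹ * ((g2 x / g1 x : ℝ):ℂ)) x := by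
    intro x hx
    have e1 := hasDerivAt_ee (h0 x hx)
    have e2 : HasDerivAt (fun x => ((2 * π * g1 x : ℝ) : ℂ) * Complex.I) (((2 * π * g2 x : ℝ) : ℂ) * Complex.I) x :=
      (((h1 x hx).const_mul (2 * π)).ofReal_comp).mul_const _
    have hg : (g1 x : ℂ) ≠ 0 := by exact_mod_cast hne x hx
    have hπc : (π : ℂ) ≠ 0 := by exact_mod_cast hπ.ne'
    have hn : ((2 * π * g1 x : ℝ) : ℂ) * Complex.I ≠ 0 := by
      push_cast; simp [hg, hπc]
    have := e1.mul (e2.inv hn)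
    refine this.congr_deriv ?_
    simp only [Pi.inv_apply]
    push_cast
    field_simp
    ring
  have hId : ∀ x ∈ Set.Ico a b, HasDerivWithinAt (fun x => ∫ t in a..x, ee (g t)) (ee (g x)) (Set.Ici x) x := by
    intro x hx
    have hii : IntervalIntegrable (fun t => ee (g t)) MeasureTheory.volume a x :=
      (hcg.mono (by rw [Set.uIcc_of_le hx.1]; exact Set.Icc_subset_Icc_right hx.2.le)).intervalIntegrable
    have hct : ContinuousAt (fun t => ee (g t)) x :=
      continuous_ee.continuousAt.comp (h0 x ⟨hx.1, hx.2.le⟩).continuousAt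
    refine intervalIntegral.integral_hasDerivWithinAt_right hii (t := Set.Ioi x) (s := Set.Ici x) ?_ hct.continuousWithinAt
    have : ContinuousOn (fun t => ee (g t)) (Set.Icc x b) := hcg.mono (Set.Icc_subset_Icc_left hx.1)
    refine ⟨Set.Icc x b, ?_, this.aestronglyMeasurable measurableSet_Icc⟩
    exact mem_nhdsWithin.mpr ⟨Set.Iio b, isOpen_Iio, hx.2, fun y hy => ⟨hy.2.le, hy.1.le⟩⟩
  have hIc : ContinuousOn (fun x => ∫ t in a..x, ee (g t)) (Set.Icc a b) :=
    intervalIntegral.continuousOn_primitive_interval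
      ((hcg.integrableOn_Icc).mono_set (by rw [Set.uIcc_of_le hab]))|>.mono (by rw [Set.uIcc_of_le hab])
  have key := image_norm_le_of_norm_deriv_right_le_deriv_boundary' (f := H)
    (f' := fun x => ee (g x) * (((2 * π * g1 x : ℝ) : ℂ) * Complex.I)⁻¹ * ((g2 x / g1 x : ℝ):ℂ))
    (a := a) (b := b)
    (B := fun x => (1 / (2 * π)) * ((g1 a)⁻¹ - (g1 x)⁻¹))
    (B' := fun x => (1 / (2 * π)) * (g2 x / (g1 x) ^ 2))
    ?_ ?_ ?_ ?_ ?_ ?_ (Set.right_mem_Icc.mpr hab)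
  · have hΦn : ∀ x, ‖Φ x‖ = (1 / (2 * π)) * |g1 x|⁻¹ := by
      intro x
      simp only [hΦ, norm_mul, norm_ee, norm_inv, Complex.norm_real, Complex.norm_I, Real.norm_eq_abs, abs_mul,
        abs_of_pos hπ]
      simp [mul_comm]
    have e : (∫ x in a..b, ee (g x)) = H b + Φ b - Φ a := by simp only [hH]; ring
    rw [e]
    have t1 : ‖H b + Φ b - Φ a‖ ≤ ‖H b‖ + ‖Φ b‖ + ‖Φ a‖ :=
      (norm_sub_le _ _).trans (by gcongr; exact norm_add_le _ _)
    refine t1.trans ?_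
    rw [hΦn, hΦn]
    have q1 : |g1 a|⁻¹ ≤ μ⁻¹ := inv_anti₀ hμ ha
    have q2 : |g1 b|⁻¹ ≤ μ⁻¹ := inv_anti₀ hμ hb
    have q3 : (g1 a)⁻¹ - (g1 b)⁻¹ ≤ |g1 a|⁻¹ + |g1 b|⁻¹ := by
      rw [← abs_inv, ← abs_inv]
      linarith [le_abs_self (g1 a)⁻¹, neg_abs_le (g1 b)⁻¹]
    have q4 : 1 / (2 * π) ≤ 1 / 4 := by
      have := Real.pi_gt_three
      exact one_div_le_one_div_of_le (by norm_num) (by linarith)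
    have q5 : 0 ≤ |g1 a|⁻¹ := by positivity
    have q6 : 0 ≤ |g1 b|⁻¹ := by positivity
    have q7 : 0 < 1 / (2 * π) := by positivity
    have q8 : 0 < μ⁻¹ := by positivity
    calc _ ≤ (1 / (2 * π)) * (4 * μ⁻¹) := by nlinarith
      _ ≤ (1/4) * (4 * μ⁻¹) := by gcongr
      _ = _ := by rw [one_div]; ring
  · refine ((hIc.sub ?_).add continuousOn_const)
    exact fun x hx => (hΦd x hx).continuousAt.continuousWithinAt
  · intro x hx
    have := ((hId x hx).sub (hΦd x ⟨hx.1, hx.2.le⟩).hasDerivWithinAt).add_const (Φ a)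
    exact this.congr_deriv (by ring)
  · simp [hH]
  · refine continuousOn_const.mul (continuousOn_const.sub ?_)
    exact ContinuousOn.inv₀ (fun x hx => (h1 x hx).continuousAt.continuousWithinAt) hne
  · intro x hx
    have hx' : x ∈ Set.Icc a b := ⟨hx.1, hx.2.le⟩
    have := (((h1 x hx').inv (hne x hx')).const_sub ((g1 a)⁻¹)).const_mul (1 / (2 * π))
    refine (this.congr_deriv ?_).hasDerivWithinAt
    ring
  · intro x hx
    have hx' : x ∈ Set.Icc a b := ⟨hx.1, hx.2.le⟩
    simp only [norm_mul, norm_ee, norm_inv, Complex.norm_real, Complex.norm_I, Real.norm_eq_abs, abs_mul,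
        abs_of_pos hπ, abs_div, abs_of_nonneg (h2 x hx')]
    have : 0 < |g1 x| := abs_pos.mpr (hne x hx')
    rw [← sq_abs (g1 x)]
    apply le_of_eq
    rw [show |(2:ℝ)| = 2 by norm_num]
    field_simp

noncomputable def fres (R : ℝ) : ℂ := ∫ y in (-R)..R, ee (y ^ 2 / 2)

theorem fres_diff {R R' : ℝ} (hR : 0 < R) (h : R ≤ R') : ‖fres R' - fres R‖ ≤ 2 / R := by
  have hi : ∀ a b : ℝ, IntervalIntegrable (fun y : ℝ => ee (y ^ 2 / 2)) MeasureTheory.volume a b :=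
    fun a b => (continuous_ee.comp (by fun_prop)).intervalIntegrable a b
  have e : fres R' - fres R = (∫ y in (-R')..(-R), ee (y ^ 2 / 2)) + ∫ y in R..R', ee (y ^ 2 / 2) := by
    unfold fres
    rw [← intervalIntegral.integral_add_adjacent_intervals (hi (-R') (-R)) (hi (-R) R'),
      ← intervalIntegral.integral_add_adjacent_intervals (hi (-R) R) (hi R R')]
    ring
  have d0 : ∀ x : ℝ, HasDerivAt (fun y : ℝ => y ^ 2 / 2) x x := by
    intro x
    have := (hasDerivAt_pow 2 x).div_const 2
    refine this.congr_deriv ?_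
    simp
  have d1 : ∀ x : ℝ, HasDerivAt (fun y : ℝ => y) ((fun _ => (1:ℝ)) x) x := fun x => hasDerivAt_id x
  have i1 : ‖∫ y in (-R')..(-R), ee (y ^ 2 / 2)‖ ≤ 1 / R := by
    refine fdt (g1 := fun y => y) (g2 := fun _ => 1) (by linarith) hR (fun x _ => d0 x) (fun x _ => d1 x) (fun _ _ => zero_le_one) ?_ ?_ ?_
    · intro x hx; have := hx.2; intro h0; linarith
    · simp only [abs_neg]; rw [abs_of_pos (by linarith)]; exact h
    · simp only [abs_neg]; rw [abs_of_pos (by linarith)]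
  have i2 : ‖∫ y in R..R', ee (y ^ 2 / 2)‖ ≤ 1 / R := by
    refine fdt (g1 := fun y => y) (g2 := fun _ => 1) (by linarith) hR (fun x _ => d0 x) (fun x _ => d1 x) (fun _ _ => zero_le_one) ?_ ?_ ?_
    · intro x hx; have := hx.1; intro h0; linarith
    · rw [abs_of_pos (by linarith)]
    · rw [abs_of_pos (by linarith)]; exact h
  rw [e]
  refine (norm_add_le _ _).trans ?_
  calc _ ≤ 1 / R + 1 / R := by gcongr
    _ = _ := by ring

theorem fresnel : ∃ κ : ℂ, ∀ R : ℝ, 0 < R → ‖fres R - κ‖ ≤ 2 / R := by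
  have hc : CauchySeq fres := by
    rw [Metric.cauchySeq_iff']
    intro ε hε
    refine ⟨3 / ε, fun n hn => ?_⟩
    rw [dist_eq_norm]
    have h3 : 0 < 3 / ε := by positivity
    refine (fres_diff h3 hn).trans_lt ?_
    rw [div_lt_iff₀ h3]
    rw [mul_div_cancel₀ _ hε.ne']; norm_num
  obtain ⟨κ, hκ⟩ := cauchySeq_tendsto_of_complete hc
  refine ⟨κ, fun R hR => ?_⟩
  rw [norm_sub_rev]
  refine le_of_tendsto ((hκ.sub_const (fres R)).norm) ?_
  filter_upwards [Filter.eventually_ge_atTop R] with R' hR'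
  exact fres_diff hR hR'

theorem fres_scale {lam δ : ℝ} (hl : 0 < lam) :
    (∫ u in (-δ)..δ, ee (lam * u ^ 2 / 2)) = ((1 / √lam : ℝ) : ℂ) * fres (δ * √lam) := by
  have hs : 0 < √lam := Real.sqrt_pos.mpr hl
  have := intervalIntegral.integral_comp_mul_right (a := -δ) (b := δ) (fun y => ee (y ^ 2 / 2)) hs.ne'
  unfold fres
  rw [show -(δ * √lam) = -δ * √lam by ring]
  have e : ∀ u : ℝ, ee (lam * u ^ 2 / 2) = ee ((u * √lam) ^ 2 / 2) := by
    intro u; rw [mul_pow, Real.sq_sqrt hl.le]; ring_nf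
  simp only [e]
  rw [this, one_div, Complex.real_smul]

theorem slope_lower {a b c : ℝ} {f f' : ℝ → ℝ} (h : ∀ x ∈ Set.Icc a b, HasDerivAt f (f' x) x)
    (hc : ∀ x ∈ Set.Icc a b, c ≤ f' x) {x y : ℝ} (hx : a ≤ x) (hxy : x ≤ y) (hy : y ≤ b) :
    c * (y - x) ≤ f y - f x := by
  rcases hxy.eq_or_lt with h0 | h0
  · subst h0; simp
  obtain ⟨z, hz, e⟩ := exists_hasDerivAt_eq_slope f f' h0
    (fun t ht => (h t ⟨hx.trans ht.1, ht.2.trans hy⟩).continuousAt.continuousWithinAt)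
    (fun t ht => h t ⟨hx.trans ht.1.le, ht.2.le.trans hy⟩)
  have := hc z ⟨hx.trans hz.1.le, hz.2.le.trans hy⟩
  rw [e, le_div_iff₀ (by linarith)] at this
  exact this

theorem slope_upper {a b c : ℝ} {f f' : ℝ → ℝ} (h : ∀ x ∈ Set.Icc a b, HasDerivAt f (f' x) x)
    (hc : ∀ x ∈ Set.Icc a b, f' x ≤ c) {x y : ℝ} (hx : a ≤ x) (hxy : x ≤ y) (hy : y ≤ b) :
    f y - f x ≤ c * (y - x) := by
  have := slope_lower (f := fun x => - f x) (f' := fun x => - f' x) (c := -c)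
    (fun x hx => (h x hx).neg) (fun x hx => by have := hc x hx; linarith) hx hxy hy
  linarith

theorem slope_abs {a b c : ℝ} {f f' : ℝ → ℝ} (h : ∀ x ∈ Set.Icc a b, HasDerivAt f (f' x) x)
    (hc : ∀ x ∈ Set.Icc a b, |f' x| ≤ c) {x y : ℝ} (hx : x ∈ Set.Icc a b) (hy : y ∈ Set.Icc a b) :
    |f y - f x| ≤ c * |y - x| := by
  have := (convex_Icc a b).norm_image_sub_le_of_norm_hasDerivWithin_le (f := f) (f' := f') (C := c)
    (fun x hx => (h x hx).hasDerivWithinAt) hc hx hy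
  simpa using this

theorem taylor3 {a b l3 : ℝ} {g g1 g2 g3 : ℝ → ℝ}
    (h0 : ∀ x ∈ Set.Icc a b, HasDerivAt g (g1 x) x)
    (h1 : ∀ x ∈ Set.Icc a b, HasDerivAt g1 (g2 x) x)
    (h2 : ∀ x ∈ Set.Icc a b, HasDerivAt g2 (g3 x) x)
    (h3 : ∀ x ∈ Set.Icc a b, |g3 x| ≤ l3) {x0 x : ℝ} (hx0 : x0 ∈ Set.Icc a b) (hx : x ∈ Set.Icc a b)
    (hg : g1 x0 = 0) :
    |g x - (g x0 + g2 x0 * (x - x0) ^ 2 / 2)| ≤ l3 * |x - x0| ^ 3 := by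
  have hl : 0 ≤ l3 := (abs_nonneg _).trans (h3 x0 hx0)
  have hsub : ∀ t ∈ Set.uIcc x0 x, t ∈ Set.Icc a b := fun t ht => Set.uIcc_subset_Icc hx0 hx ht
  have habs : ∀ t ∈ Set.uIcc x0 x, |t - x0| ≤ |x - x0| := fun t ht => Set.abs_sub_left_of_mem_uIcc ht
  have s2 : ∀ t ∈ Set.Icc a b, |g2 t - g2 x0| ≤ l3 * |t - x0| := fun t ht => slope_abs h2 h3 hx0 ht
  have s1 : ∀ t ∈ Set.uIcc x0 x, |g1 t - g2 x0 * (t - x0)| ≤ (l3 * |x - x0|) * |x - x0| := by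
    intro t ht
    have := (convex_uIcc x0 x).norm_image_sub_le_of_norm_hasDerivWithin_le
      (f := fun t => g1 t - g2 x0 * (t - x0)) (f' := fun t => g2 t - g2 x0) (C := l3 * |x - x0|)
      (fun t ht => ((h1 t (hsub t ht)).sub (((hasDerivAt_id t).sub_const x0).const_mul (g2 x0)) |>.congr_deriv (by simp)).hasDerivWithinAt)
      (fun t ht => by
        rw [Real.norm_eq_abs]
        exact (s2 t (hsub t ht)).trans (mul_le_mul_of_nonneg_left (habs t ht) hl))
      Set.left_mem_uIcc ht
    simp only [Real.norm_eq_abs, hg, sub_self, mul_zero, sub_zero] at this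
    exact this.trans (mul_le_mul_of_nonneg_left (habs t ht) (by positivity))
  have := (convex_uIcc x0 x).norm_image_sub_le_of_norm_hasDerivWithin_le
      (f := fun t => g t - (g x0 + g2 x0 * (t - x0) ^ 2 / 2)) (f' := fun t => g1 t - g2 x0 * (t - x0)) (C := (l3 * |x - x0|) * |x - x0|)
      (fun t ht => ((h0 t (hsub t ht)).sub ((((((hasDerivAt_id t).sub_const x0).pow 2).const_mul (g2 x0)).div_const 2).const_add (g x0)) |>.congr_deriv (by simp; ring)).hasDerivWithinAt)
      (fun t ht => s1 t ht)
      Set.left_mem_uIcc Set.right_mem_uIcc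
  simp only [Real.norm_eq_abs, sub_self] at this
  calc _ ≤ _ := by simpa using this
    _ = _ := by ring

theorem statphase {κ : ℂ} (hκ : ∀ R : ℝ, 0 < R → ‖fres R - κ‖ ≤ 2 / R) {a b x0 δ lam l3 : ℝ}
    (hl : 0 < lam) (hδ : 0 < δ) (ha : a ≤ x0 - δ) (hb : x0 + δ ≤ b) {g g1 g2 g3 : ℝ → ℝ}
    (h0 : ∀ x ∈ Set.Icc a b, HasDerivAt g (g1 x) x)
    (h1 : ∀ x ∈ Set.Icc a b, HasDerivAt g1 (g2 x) x)
    (h2 : ∀ x ∈ Set.Icc a b, HasDerivAt g2 (g3 x) x)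
    (h3 : ∀ x ∈ Set.Icc a b, |g3 x| ≤ l3) (hlam : ∀ x ∈ Set.Icc a b, lam ≤ g2 x) (hg : g1 x0 = 0) :
    ‖(∫ x in a..b, ee (g x)) - ee (g x0) * (((1 / √(g2 x0) : ℝ):ℂ) * κ)‖ ≤ 4 / (lam * δ) + 13 * l3 * δ ^ 4 := by
  have hx0 : x0 ∈ Set.Icc a b := ⟨by linarith, by linarith⟩
  have hl3 : 0 ≤ l3 := (abs_nonneg _).trans (h3 x0 hx0)
  have hcg : ContinuousOn (fun x => ee (g x)) (Set.Icc a b) :=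
    continuous_ee.comp_continuousOn (fun x hx => (h0 x hx).continuousAt.continuousWithinAt)
  have hi : ∀ c d, c ∈ Set.Icc a b → d ∈ Set.Icc a b → IntervalIntegrable (fun x => ee (g x)) MeasureTheory.volume c d :=
    fun c d hc hd => (hcg.mono (Set.uIcc_subset_Icc hc hd)).intervalIntegrable
  have ma : a ∈ Set.Icc a b := ⟨le_rfl, by linarith⟩
  have mb : b ∈ Set.Icc a b := ⟨by linarith, le_rfl⟩
  have mc : x0 - δ ∈ Set.Icc a b := ⟨by linarith, by linarith⟩
  have md : x0 + δ ∈ Set.Icc a b := ⟨by linarith, by linarith⟩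
  have hld : 0 < lam * δ := by positivity
  -- slopes
  have sl : ∀ x, a ≤ x → x ≤ x0 - δ → g1 x ≤ - (lam * δ) := by
    intro x h h'
    have := slope_lower h1 hlam h (show x ≤ x0 by linarith) hx0.2
    rw [hg] at this
    nlinarith
  have sr : ∀ x, x ≤ b → x0 + δ ≤ x → lam * δ ≤ g1 x := by
    intro x h h'
    have := slope_lower h1 hlam hx0.1 (show x0 ≤ x by linarith) h
    rw [hg] at this
    nlinarith
  have i1 : ‖∫ x in a..(x0 - δ), ee (g x)‖ ≤ 1 / (lam * δ) := by
    have sub : ∀ x ∈ Set.Icc a (x0 - δ), x ∈ Set.Icc a b := fun x hx => ⟨hx.1, by linarith [hx.2]⟩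
    refine fdt ha hld (fun x hx => h0 x (sub x hx)) (fun x hx => h1 x (sub x hx))
      (fun x hx => hl.le.trans (hlam x (sub x hx))) ?_ ?_ ?_
    · intro x hx; have := sl x hx.1 hx.2; intro h; linarith
    · have := sl a le_rfl ha; rw [abs_of_neg (by linarith)]; linarith
    · have := sl _ ha le_rfl; rw [abs_of_neg (by linarith)]; linarith
  have i2 : ‖∫ x in (x0 + δ)..b, ee (g x)‖ ≤ 1 / (lam * δ) := by
    have sub : ∀ x ∈ Set.Icc (x0 + δ) b, x ∈ Set.Icc a b := fun x hx => ⟨by linarith [hx.1], hx.2⟩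
    refine fdt hb hld (fun x hx => h0 x (sub x hx)) (fun x hx => h1 x (sub x hx))
      (fun x hx => hl.le.trans (hlam x (sub x hx))) ?_ ?_ ?_
    · intro x hx; have := sr x hx.2 hx.1; intro h; linarith
    · have := sr _ hb le_rfl; rw [abs_of_pos (by linarith)]; linarith
    · have := sr b le_rfl hb; rw [abs_of_pos (by linarith)]; linarith
  have i3 : ‖(∫ x in (x0 - δ)..(x0 + δ), ee (g x)) - ∫ x in (x0 - δ)..(x0 + δ), ee (g x0 + g2 x0 * (x - x0) ^ 2 / 2)‖
      ≤ 13 * l3 * δ ^ 4 := by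
    have hq : IntervalIntegrable (fun x : ℝ => ee (g x0 + g2 x0 * (x - x0) ^ 2 / 2)) MeasureTheory.volume (x0 - δ) (x0 + δ) :=
      (continuous_ee.comp (by fun_prop : Continuous (fun x : ℝ => g x0 + g2 x0 * (x - x0) ^ 2 / 2))).intervalIntegrable _ _
    rw [← intervalIntegral.integral_sub (hi _ _ mc md) hq]
    have := intervalIntegral.norm_integral_le_of_norm_le_const (a := x0 - δ) (b := x0 + δ)
      (f := fun x => ee (g x) - ee (g x0 + g2 x0 * (x - x0) ^ 2 / 2)) (C := 2 * π * (l3 * δ ^ 3)) (by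
      intro x hx
      rw [Set.uIoc_of_le (by linarith)] at hx
      have hx' : x ∈ Set.Icc a b := ⟨by linarith [hx.1], by linarith [hx.2]⟩
      refine (norm_ee_sub_le _ _).trans ?_
      have t := taylor3 h0 h1 h2 h3 hx0 hx' hg
      have : |x - x0| ≤ δ := abs_le.mpr ⟨by linarith [hx.1], by linarith [hx.2]⟩
      have : |x - x0| ^ 3 ≤ δ ^ 3 := by gcongr
      have : l3 * |x - x0| ^ 3 ≤ l3 * δ ^ 3 := by gcongr
      have hπ := Real.pi_pos
      gcongr
      linarith)
    refine this.trans ?_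
    rw [show x0 + δ - (x0 - δ) = 2 * δ by ring, abs_of_pos (by linarith)]
    have hπ := Real.pi_lt_d2
    have : 0 ≤ l3 * δ ^ 4 := by positivity
    nlinarith
  have hG : 0 < g2 x0 := hl.trans_le (hlam x0 hx0)
  have i4 : (∫ x in (x0 - δ)..(x0 + δ), ee (g x0 + g2 x0 * (x - x0) ^ 2 / 2)) =
      ee (g x0) * (((1 / √(g2 x0) : ℝ):ℂ) * fres (δ * √(g2 x0))) := by
    rw [← fres_scale hG]
    simp only [ee_add]
    rw [intervalIntegral.integral_const_mul]
    rw [intervalIntegral.integral_comp_sub_right (fun u => ee (g2 x0 * u ^ 2 / 2)) x0]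
    congr 2 <;> ring
  have i5 : ‖ee (g x0) * (((1 / √(g2 x0) : ℝ):ℂ) * fres (δ * √(g2 x0))) - ee (g x0) * (((1 / √(g2 x0) : ℝ):ℂ) * κ)‖
      ≤ 2 / (lam * δ) := by
    rw [← mul_sub, ← mul_sub, norm_mul, norm_mul, norm_ee, one_mul, Complex.norm_real, Real.norm_eq_abs]
    have hs : 0 < √(g2 x0) := Real.sqrt_pos.mpr hG
    rw [abs_of_pos (by positivity)]
    calc 1 / √(g2 x0) * ‖fres (δ * √(g2 x0)) - κ‖ ≤ 1 / √(g2 x0) * (2 / (δ * √(g2 x0))) := by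
          gcongr; exact hκ _ (by positivity)
      _ = 2 / (g2 x0 * δ) := by
          rw [div_mul_div_comm, one_mul]
          congr 1
          calc √(g2 x0) * (δ * √(g2 x0)) = (√(g2 x0) * √(g2 x0)) * δ := by ring
            _ = _ := by rw [Real.mul_self_sqrt hG.le]
      _ ≤ _ := by gcongr; exact hlam x0 hx0
  have split : (∫ x in a..b, ee (g x)) = (∫ x in a..(x0 - δ), ee (g x)) + (∫ x in (x0 - δ)..(x0 + δ), ee (g x))
      + ∫ x in (x0 + δ)..b, ee (g x) := by
    rw [intervalIntegral.integral_add_adjacent_intervals (hi _ _ ma mc) (hi _ _ mc md),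
      intervalIntegral.integral_add_adjacent_intervals (hi _ _ ma md) (hi _ _ md mb)]
  rw [split]
  rw [i4] at i3
  set A := ∫ x in a..(x0 - δ), ee (g x)
  set B := ∫ x in (x0 - δ)..(x0 + δ), ee (g x)
  set C := ∫ x in (x0 + δ)..b, ee (g x)
  set E := ee (g x0) * (((1 / √(g2 x0) : ℝ):ℂ) * fres (δ * √(g2 x0)))
  set F := ee (g x0) * (((1 / √(g2 x0) : ℝ):ℂ) * κ)
  calc ‖A + B + C - F‖ = ‖A + C + (B - E) + (E - F)‖ := by congr 1; ring
    _ ≤ ‖A‖ + ‖C‖ + ‖B - E‖ + ‖E - F‖ := by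
      refine (norm_add_le _ _).trans ?_
      gcongr
      refine (norm_add_le _ _).trans ?_
      gcongr
      exact norm_add_le _ _
    _ ≤ 1 / (lam * δ) + 1 / (lam * δ) + 13 * l3 * δ ^ 4 + 2 / (lam * δ) := by gcongr
    _ = _ := by ring


noncomputable def E1 (θ : ℝ) : ℂ := ∫ t in (0:ℝ)..1, ee (θ * t)
noncomputable def E2 (θ : ℝ) : ℂ := ∫ t in (0:ℝ)..1, ((1 - t : ℝ) : ℂ) * ee (θ * t)
noncomputable def phi (θ : ℝ) : ℂ := - E2 θ / E1 θ

theorem cont_eeθ (θ : ℝ) : Continuous (fun t : ℝ => ee (θ * t)) := continuous_ee.comp (by fun_prop)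
theorem cont_eeθ2 (θ : ℝ) : Continuous (fun t : ℝ => ((1 - t : ℝ) : ℂ) * ee (θ * t)) :=
  (Complex.continuous_ofReal.comp (by fun_prop)).mul (cont_eeθ θ)

theorem hd_lin (θ t : ℝ) : HasDerivAt (fun t : ℝ => θ * t) θ t := by
  simpa using (hasDerivAt_id t).const_mul θ

theorem E1_eq (θ : ℝ) : ((2 * π * θ : ℝ) : ℂ) * Complex.I * E1 θ = ee θ - 1 := by
  unfold E1
  rw [← intervalIntegral.integral_const_mul]
  rw [intervalIntegral.integral_eq_sub_of_hasDerivAt (f := fun t => ee (θ * t))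
    (fun t _ => hasDerivAt_ee (hd_lin θ t))
    ((continuous_const.mul (cont_eeθ θ)).intervalIntegrable _ _)]
  simp [ee_zero]

theorem E2_eq (θ : ℝ) : ((2 * π * θ : ℝ) : ℂ) * Complex.I * E2 θ = E1 θ - 1 := by
  have c1 : Continuous (fun t : ℝ => ((2 * π * θ : ℝ) : ℂ) * Complex.I * (((1 - t : ℝ) : ℂ) * ee (θ * t))) :=
    continuous_const.mul (cont_eeθ2 θ)
  have c2 : Continuous (fun t : ℝ => ((2 * π * θ : ℝ) : ℂ) * Complex.I * (((1 - t : ℝ) : ℂ) * ee (θ * t)) - ee (θ * t)) :=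
    c1.sub (cont_eeθ θ)
  have h : (∫ t in (0:ℝ)..1, (((2 * π * θ : ℝ) : ℂ) * Complex.I * (((1 - t : ℝ) : ℂ) * ee (θ * t)) - ee (θ * t))) = -1 := by
    rw [intervalIntegral.integral_eq_sub_of_hasDerivAt (f := fun t => ((1 - t : ℝ) : ℂ) * ee (θ * t))
      (fun t _ => ?_) (c2.intervalIntegrable _ _)]
    · simp [ee_zero]
    · have h1 : HasDerivAt (fun t : ℝ => ((1 - t : ℝ) : ℂ)) ((-1 : ℝ) : ℂ) t :=
        ((hasDerivAt_id t).const_sub 1).ofReal_comp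
      refine (h1.mul (hasDerivAt_ee (hd_lin θ t))).congr_deriv ?_
      push_cast; ring
  rw [intervalIntegral.integral_sub (c1.intervalIntegrable _ _)
    ((cont_eeθ θ).intervalIntegrable _ _), intervalIntegral.integral_const_mul] at h
  unfold E1 E2
  linear_combination h

theorem E1_ne {θ : ℝ} (h : |θ| ≤ 1 / 2) : 1 / (2 * π) ≤ ‖E1 θ‖ := by
  have hπ := Real.pi_gt_three
  rcases eq_or_ne θ 0 with h0 | h0
  · subst h0
    unfold E1
    simp [ee_zero]
    rw [← mul_inv]
    exact inv_le_one_of_one_le₀ (by nlinarith)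
  have e := congrArg norm (E1_eq θ)
  rw [norm_mul, norm_mul, Complex.norm_real, Complex.norm_I, Real.norm_eq_abs, abs_mul, abs_of_pos (by positivity : 0 < 2 * π)] at e
  have := le_norm_ee_sub_one (d := θ) (by linarith)
  rw [← e] at this
  have h1 : 0 < |θ| := abs_pos.mpr h0
  rw [div_le_iff₀ (by positivity)]
  by_contra hc; push Not at hc
  nlinarith

theorem E1_lip (θ η : ℝ) : ‖E1 θ - E1 η‖ ≤ 2 * π * |θ - η| := by
  unfold E1
  rw [← intervalIntegral.integral_sub ((cont_eeθ θ).intervalIntegrable _ _) ((cont_eeθ η).intervalIntegrable _ _)]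
  have := intervalIntegral.norm_integral_le_of_norm_le_const (a := 0) (b := 1)
    (f := fun t => ee (θ * t) - ee (η * t)) (C := 2 * π * |θ - η|) (by
      intro t ht
      rw [Set.uIoc_of_le zero_le_one] at ht
      refine (norm_ee_sub_le _ _).trans ?_
      rw [← sub_mul, abs_mul, abs_of_pos ht.1]
      have : |θ - η| * t ≤ |θ - η| * 1 := by gcongr; exact ht.2
      have hπ := Real.pi_pos
      gcongr; linarith)
  simpa using this

theorem E2_lip (θ η : ℝ) : ‖E2 θ - E2 η‖ ≤ 2 * π * |θ - η| := by
  unfold E2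
  rw [← intervalIntegral.integral_sub ((cont_eeθ2 θ).intervalIntegrable _ _) ((cont_eeθ2 η).intervalIntegrable _ _)]
  have := intervalIntegral.norm_integral_le_of_norm_le_const (a := 0) (b := 1)
    (f := fun t => ((1 - t : ℝ) : ℂ) * ee (θ * t) - ((1 - t : ℝ) : ℂ) * ee (η * t)) (C := 2 * π * |θ - η|) (by
      intro t ht
      rw [Set.uIoc_of_le zero_le_one] at ht
      rw [← mul_sub, norm_mul, Complex.norm_real, Real.norm_eq_abs, abs_of_nonneg (by linarith [ht.2])]
      have h1 := norm_ee_sub_le (θ * t) (η * t)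
      rw [← sub_mul, abs_mul, abs_of_pos ht.1] at h1
      have : |θ - η| * t ≤ |θ - η| * 1 := by gcongr; exact ht.2
      have hπ := Real.pi_pos
      calc (1 - t) * ‖ee (θ * t) - ee (η * t)‖ ≤ 1 * (2 * π * (|θ - η| * 1)) := by
            gcongr
            · linarith [ht.1]
            · refine h1.trans ?_
              gcongr
        _ = _ := by ring)
  simpa using this

theorem E2_le (θ : ℝ) : ‖E2 θ‖ ≤ 1 := by
  unfold E2
  have := intervalIntegral.norm_integral_le_of_norm_le_const (a := 0) (b := 1)
    (f := fun t => ((1 - t : ℝ) : ℂ) * ee (θ * t)) (C := 1) (by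
      intro t ht
      rw [Set.uIoc_of_le zero_le_one] at ht
      rw [norm_mul, norm_ee, Complex.norm_real, Real.norm_eq_abs, abs_of_nonneg (by linarith [ht.2])]
      linarith [ht.1])
  simpa using this

theorem phi_mul {θ : ℝ} (h : |θ| ≤ 1 / 2) : phi θ * (ee θ - 1) = 1 - E1 θ := by
  have hn : E1 θ ≠ 0 := by
    rw [← norm_pos_iff]; exact lt_of_lt_of_le (by positivity) (E1_ne h)
  rw [← E1_eq]
  unfold phi
  field_simp
  have := E2_eq θ
  linear_combination (-1) * this

theorem phi_le {θ : ℝ} (h : |θ| ≤ 1 / 2) : ‖phi θ‖ ≤ 7 := by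
  unfold phi
  have h1 := E1_ne h
  have hp := Real.pi_lt_d2
  have hp0 := Real.pi_pos
  have h0 : 0 < ‖E1 θ‖ := lt_of_lt_of_le (by positivity) h1
  rw [norm_div, norm_neg, div_le_iff₀ h0]
  have h2 : (1/7 : ℝ) ≤ 1 / (2 * π) := one_div_le_one_div_of_le (by positivity) (by linarith)
  linarith [E2_le θ]

theorem phi_lip {θ η : ℝ} (h : |θ| ≤ 1 / 2) (h' : |η| ≤ 1 / 2) : ‖phi θ - phi η‖ ≤ 400 * |θ - η| := by
  have hp := Real.pi_lt_d2
  have hp0 := Real.pi_pos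
  have h2 : (1/7 : ℝ) ≤ 1 / (2 * π) := one_div_le_one_div_of_le (by positivity) (by linarith)
  have a1 : 1/7 ≤ ‖E1 θ‖ := h2.trans (E1_ne h)
  have a2 : 1/7 ≤ ‖E1 η‖ := h2.trans (E1_ne h')
  have n1 : E1 θ ≠ 0 := by rw [← norm_pos_iff]; linarith
  have n2 : E1 η ≠ 0 := by rw [← norm_pos_iff]; linarith
  have e : (phi θ - phi η) * E1 θ = - (E2 θ - E2 η) - phi η * (E1 θ - E1 η) := by
    unfold phi
    field_simp
    ring
  have e' := congrArg norm e
  rw [norm_mul] at e'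
  have b : ‖- (E2 θ - E2 η) - phi η * (E1 θ - E1 η)‖ ≤ 2 * π * |θ - η| + 7 * (2 * π * |θ - η|) := by
    refine (norm_sub_le _ _).trans ?_
    rw [norm_neg, norm_mul]
    gcongr
    · exact E2_lip θ η
    · exact phi_le h'
    · exact E1_lip θ η
  rw [← e'] at b
  have := norm_nonneg (phi θ - phi η)
  have := abs_nonneg (θ - η)
  have b2 : 2 * π * |θ - η| ≤ 7 * |θ - η| := by gcongr; linarith
  nlinarith

/-- one unit step -/
theorem unit_step {m lam : ℝ} {g g1 g2 : ℝ → ℝ}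
    (h0 : ∀ x ∈ Set.Icc m (m+1), HasDerivAt g (g1 x) x)
    (h1 : ∀ x ∈ Set.Icc m (m+1), HasDerivAt g1 (g2 x) x)
    (h2 : ∀ x ∈ Set.Icc m (m+1), |g2 x| ≤ lam) (hg : ∀ x ∈ Set.Icc m (m+1), |g1 x| ≤ 1 / 2) :
    ‖ee (g m) - (∫ x in m..(m+1), ee (g x)) - (phi (g1 (m+1)) * ee (g (m+1)) - phi (g1 m) * ee (g m))‖ ≤ 500 * lam := by
  have hp := Real.pi_lt_d2
  have hp0 := Real.pi_pos
  have mm : m ∈ Set.Icc m (m+1) := ⟨le_rfl, by linarith⟩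
  have mm1 : m + 1 ∈ Set.Icc m (m+1) := ⟨by linarith, le_rfl⟩
  have hl : 0 ≤ lam := (abs_nonneg _).trans (h2 m mm)
  have hcg : ContinuousOn (fun x => ee (g x)) (Set.Icc m (m+1)) :=
    continuous_ee.comp_continuousOn (fun x hx => (h0 x hx).continuousAt.continuousWithinAt)
  have s1 : ∀ t ∈ Set.Icc m (m+1), |g1 t - g1 m| ≤ lam := by
    intro t ht
    refine (slope_abs h1 h2 mm ht).trans ?_
    have : |t - m| ≤ 1 := abs_le.mpr ⟨by linarith [ht.1], by linarith [ht.2]⟩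
    nlinarith
  have s0 : ∀ t ∈ Set.Icc m (m+1), |g t - (g m + g1 m * (t - m))| ≤ lam := by
    intro t ht
    have := slope_abs (f := fun t => g t - (g m + g1 m * (t - m))) (f' := fun t => g1 t - g1 m) (c := lam)
      (a := m) (b := m + 1)
      (fun t ht => ((h0 t ht).sub ((((hasDerivAt_id t).sub_const m).const_mul (g1 m)).const_add (g m))).congr_deriv (by simp)) s1 mm ht
    have h : |t - m| ≤ 1 := abs_le.mpr ⟨by linarith [ht.1], by linarith [ht.2]⟩
    simp only [sub_self, mul_zero, add_zero, sub_zero] at this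
    nlinarith
  set θ := g1 m with hθ
  have c1 : ‖(∫ x in m..(m+1), ee (g x)) - ee (g m) * E1 θ‖ ≤ 2 * π * lam := by
    have hq : Continuous (fun x : ℝ => ee (g m + θ * (x - m))) := continuous_ee.comp (by fun_prop)
    have e : ee (g m) * E1 θ = ∫ x in m..(m+1), ee (g m + θ * (x - m)) := by
      simp only [ee_add]
      rw [intervalIntegral.integral_const_mul, intervalIntegral.integral_comp_sub_right (fun u => ee (θ * u)) m]
      simp [E1]
    rw [e, ← intervalIntegral.integral_sub ((hcg.mono (by rw [Set.uIcc_of_le (by linarith)])).intervalIntegrable) (hq.intervalIntegrable _ _)]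
    have := intervalIntegral.norm_integral_le_of_norm_le_const (a := m) (b := m + 1)
      (f := fun x => ee (g x) - ee (g m + θ * (x - m))) (C := 2 * π * lam) (by
      intro x hx
      rw [Set.uIoc_of_le (by linarith)] at hx
      refine (norm_ee_sub_le _ _).trans ?_
      have := s0 x ⟨hx.1.le, hx.2⟩
      gcongr)
    simpa using this
  have c2 : ‖ee (g (m+1)) - ee (g m) * ee θ‖ ≤ 2 * π * lam := by
    rw [← ee_add]
    refine (norm_ee_sub_le _ _).trans ?_
    have := s0 (m+1) mm1
    rw [show g m + θ * (m + 1 - m) = g m + θ by ring] at this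
    gcongr
  have c3 : ‖phi (g1 (m+1)) - phi θ‖ ≤ 400 * lam := by
    refine (phi_lip (hg _ mm1) (hg _ mm)).trans ?_
    have := s1 (m+1) mm1
    gcongr
  have c4 := phi_mul (hg m mm)
  have c5 := phi_le (hg m mm)
  rw [← hθ] at c4 c5
  set I := ∫ x in m..(m+1), ee (g x)
  have e : ee (g m) - I - (phi (g1 (m+1)) * ee (g (m+1)) - phi θ * ee (g m)) =
      - (I - ee (g m) * E1 θ) - (phi (g1 (m+1)) - phi θ) * ee (g (m+1)) - phi θ * (ee (g (m+1)) - ee (g m) * ee θ) := by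
    linear_combination - (ee (g m)) * c4
  rw [e]
  calc _ ≤ ‖I - ee (g m) * E1 θ‖ + ‖phi (g1 (m+1)) - phi θ‖ * 1 + ‖phi θ‖ * ‖ee (g (m+1)) - ee (g m) * ee θ‖ := by
        refine (norm_sub_le _ _).trans ?_
        rw [norm_mul (phi θ)]
        gcongr
        refine (norm_sub_le _ _).trans ?_
        rw [norm_neg, norm_mul, norm_ee]
    _ ≤ 2 * π * lam + 400 * lam * 1 + 7 * (2 * π * lam) := by gcongr
    _ ≤ _ := by nlinarith

theorem lemmaA_nat {p q : ℕ} (hpq : p ≤ q) {lam : ℝ} {g g1 g2 : ℝ → ℝ}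
    (h0 : ∀ x ∈ Set.Icc (p:ℝ) q, HasDerivAt g (g1 x) x)
    (h1 : ∀ x ∈ Set.Icc (p:ℝ) q, HasDerivAt g1 (g2 x) x)
    (h2 : ∀ x ∈ Set.Icc (p:ℝ) q, |g2 x| ≤ lam) (hg : ∀ x ∈ Set.Icc (p:ℝ) q, |g1 x| ≤ 1 / 2) :
    ‖(∑ m ∈ Finset.Ico p q, ee (g m)) - ∫ x in (p:ℝ)..q, ee (g x)‖ ≤ 14 + 500 * (lam * (q - p)) := by
  have hcg : ContinuousOn (fun x => ee (g x)) (Set.Icc (p:ℝ) q) :=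
    continuous_ee.comp_continuousOn (fun x hx => (h0 x hx).continuousAt.continuousWithinAt)
  have key : ∀ n, p ≤ n → n ≤ q → ‖(∑ m ∈ Finset.Ico p n, ee (g m)) - (∫ x in (p:ℝ)..n, ee (g x))
      - (phi (g1 n) * ee (g n) - phi (g1 p) * ee (g p))‖ ≤ 500 * (lam * (n - p)) := by
    intro n hn
    induction n, hn using Nat.le_induction with
    | base => intro _; simp
    | succ n hn ih =>
      intro hq
      have ih' := ih (by omega)
      have hnp : (p:ℝ) ≤ n := by exact_mod_cast hn
      have hnq : (n:ℝ) + 1 ≤ q := by exact_mod_cast hq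
      have sub : ∀ x ∈ Set.Icc (n:ℝ) (n+1), x ∈ Set.Icc (p:ℝ) q := fun x hx => ⟨by linarith [hx.1], by linarith [hx.2]⟩
      have st := unit_step (m := n) (lam := lam) (fun x hx => h0 x (sub x hx)) (fun x hx => h1 x (sub x hx))
        (fun x hx => h2 x (sub x hx)) (fun x hx => hg x (sub x hx))
      rw [Finset.sum_Ico_succ_top hn]
      push_cast
      rw [← intervalIntegral.integral_add_adjacent_intervals (a := (p:ℝ)) (b := n) (c := n + 1)
        ((hcg.mono (by rw [Set.uIcc_of_le hnp]; exact Set.Icc_subset_Icc_right (by linarith))).intervalIntegrable)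
        ((hcg.mono (by rw [Set.uIcc_of_le (by linarith)]; exact Set.Icc_subset_Icc hnp hnq)).intervalIntegrable)]
      calc _ = ‖((∑ m ∈ Finset.Ico p n, ee (g m)) - (∫ x in (p:ℝ)..n, ee (g x))
            - (phi (g1 n) * ee (g n) - phi (g1 p) * ee (g p))) + (ee (g n) - (∫ x in (n:ℝ)..(n+1), ee (g x)) - (phi (g1 (n+1)) * ee (g (n+1)) - phi (g1 n) * ee (g n)))‖ := by
              congr 1; ring
        _ ≤ 500 * (lam * (n - p)) + 500 * lam := (norm_add_le _ _).trans (add_le_add ih' st)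
        _ = _ := by ring
  have hpq' : (p:ℝ) ≤ q := by exact_mod_cast hpq
  have k := key q hpq le_rfl
  have b1 := phi_le (hg q ⟨hpq', le_rfl⟩)
  have b2 := phi_le (hg p ⟨le_rfl, hpq'⟩)
  set X := (∑ m ∈ Finset.Ico p q, ee (g m)) - ∫ x in (p:ℝ)..q, ee (g x)
  calc ‖X‖ = ‖(X - (phi (g1 q) * ee (g q) - phi (g1 p) * ee (g p))) + (phi (g1 q) * ee (g q) - phi (g1 p) * ee (g p))‖ := by
        congr 1; ring
    _ ≤ 500 * (lam * (q - p)) + (7 * 1 + 7 * 1) := by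
        refine (norm_add_le _ _).trans (add_le_add k ((norm_sub_le _ _).trans ?_))
        rw [norm_mul, norm_mul, norm_ee, norm_ee]
        gcongr
    _ = _ := by ring

theorem int_triv {a b : ℝ} (hab : a ≤ b) (g : ℝ → ℝ) : ‖∫ x in a..b, ee (g x)‖ ≤ b - a := by
  have := intervalIntegral.norm_integral_le_of_norm_le_const (a := a) (b := b)
    (f := fun x => ee (g x)) (C := 1) (fun x _ => (norm_ee _).le)
  rwa [one_mul, abs_of_nonneg (by linarith)] at this

theorem lemmaA {a b : ℝ} (ha : 0 ≤ a) (hab : a ≤ b) {lam : ℝ} (hl : 0 ≤ lam) {g g1 g2 : ℝ → ℝ}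
    (h0 : ∀ x ∈ Set.Icc a b, HasDerivAt g (g1 x) x)
    (h1 : ∀ x ∈ Set.Icc a b, HasDerivAt g1 (g2 x) x)
    (h2 : ∀ x ∈ Set.Icc a b, |g2 x| ≤ lam) (hg : ∀ x ∈ Set.Icc a b, |g1 x| ≤ 1 / 2) :
    ‖(∑ m ∈ Finset.Ioc ⌊a⌋₊ ⌊b⌋₊, ee (g m)) - ∫ x in a..b, ee (g x)‖ ≤ 20 + 500 * (lam * (b - a)) := by
  have hcg : ContinuousOn (fun x => ee (g x)) (Set.Icc a b) :=
    continuous_ee.comp_continuousOn (fun x hx => (h0 x hx).continuousAt.continuousWithinAt)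
  have fa := Nat.lt_floor_add_one a
  have fa' := Nat.floor_le ha
  have fb := Nat.lt_floor_add_one b
  have fb' := Nat.floor_le (ha.trans hab)
  have hba : 0 ≤ lam * (b - a) := mul_nonneg hl (by linarith)
  rcases Nat.lt_or_ge ⌊a⌋₊ ⌊b⌋₊ with hlt | hge
  · set p := ⌊a⌋₊ + 1 with hp
    set q := ⌊b⌋₊ with hq
    have hpa : a ≤ p := by rw [hp]; push_cast; exact fa.le
    have hpa1 : (p:ℝ) ≤ a + 1 := by rw [hp]; push_cast; linarith
    have hpq : p ≤ q := hlt
    have hpq' : (p:ℝ) ≤ q := by exact_mod_cast hpq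
    have sub : ∀ x ∈ Set.Icc (p:ℝ) q, x ∈ Set.Icc a b := fun x hx => ⟨by linarith [hx.1], by linarith [hx.2]⟩
    have k := lemmaA_nat hpq (fun x hx => h0 x (sub x hx)) (fun x hx => h1 x (sub x hx))
        (fun x hx => h2 x (sub x hx)) (fun x hx => hg x (sub x hx))
    have es : Finset.Ioc ⌊a⌋₊ q = Finset.Ico p (q + 1) := by
      ext x; simp only [Finset.mem_Ioc, Finset.mem_Ico]; omega
    rw [es, Finset.sum_Ico_succ_top hpq]
    have hi : ∀ c d, c ∈ Set.Icc a b → d ∈ Set.Icc a b → IntervalIntegrable (fun x => ee (g x)) MeasureTheory.volume c d :=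
      fun c d hc hd => (hcg.mono (Set.uIcc_subset_Icc hc hd)).intervalIntegrable
    have ma : a ∈ Set.Icc a b := ⟨le_rfl, hab⟩
    have mb : b ∈ Set.Icc a b := ⟨hab, le_rfl⟩
    have mp : (p:ℝ) ∈ Set.Icc a b := ⟨hpa, by linarith⟩
    have mq : (q:ℝ) ∈ Set.Icc a b := ⟨by linarith, fb'⟩
    rw [← intervalIntegral.integral_add_adjacent_intervals (hi _ _ ma mp) (hi _ _ mp mb),
      ← intervalIntegral.integral_add_adjacent_intervals (hi _ _ mp mq) (hi _ _ mq mb)]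
    have t1 := int_triv hpa g
    have t2 := int_triv fb' g
    set X := ∑ m ∈ Finset.Ico p q, ee (g m)
    set I1 := ∫ x in a..p, ee (g x)
    set I2 := ∫ x in (p:ℝ)..q, ee (g x)
    set I3 := ∫ x in (q:ℝ)..b, ee (g x)
    have hlq : lam * (q - p) ≤ lam * (b - a) := by gcongr
    calc ‖X + ee (g q) - (I1 + (I2 + I3))‖ = ‖(X - I2) + ee (g q) - I1 - I3‖ := by congr 1; ring
      _ ≤ ‖X - I2‖ + ‖ee (g q)‖ + ‖I1‖ + ‖I3‖ := by
        refine (norm_sub_le _ _).trans ?_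
        gcongr
        refine (norm_sub_le _ _).trans ?_
        gcongr
        exact norm_add_le _ _
      _ ≤ (14 + 500 * (lam * (q - p))) + 1 + 1 + 1 := by
        rw [norm_ee]
        gcongr
        · linarith
        · linarith
      _ ≤ _ := by linarith
  · rw [Finset.Ioc_eq_empty (by omega), Finset.sum_empty, zero_sub, norm_neg]
    have : (⌊b⌋₊:ℝ) ≤ ⌊a⌋₊ := by exact_mod_cast hge
    have := int_triv hab g
    linarith

theorem block {κ : ℂ} (hκ : ∀ R : ℝ, 0 < R → ‖fres R - κ‖ ≤ 2 / R) {a b x0 δ lam l3 C : ℝ}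
    (ha : 0 ≤ a) (hax : a ≤ x0) (hxb : x0 ≤ b) (hC : 1 ≤ C)
    (hl : 0 < lam) (hδ : 0 < δ) (hδ' : 2 * C * lam * δ ≤ 1) {g g1 g2 g3 : ℝ → ℝ}
    (h0 : ∀ x ∈ Set.Icc a b, HasDerivAt g (g1 x) x)
    (h1 : ∀ x ∈ Set.Icc a b, HasDerivAt g1 (g2 x) x)
    (h2 : ∀ x ∈ Set.Icc a b, HasDerivAt g2 (g3 x) x)
    (h3 : ∀ x ∈ Set.Icc a b, |g3 x| ≤ l3) (hlam : ∀ x ∈ Set.Icc a b, lam ≤ g2 x)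
    (hlam' : ∀ x ∈ Set.Icc a b, g2 x ≤ C * lam)
    (hg : g1 x0 = 0) (hga : g1 a = - (1/2)) (hgb : g1 b = 1 / 2) :
    ‖(∑ m ∈ Finset.Ioc ⌊a⌋₊ ⌊b⌋₊, ee (g m)) - ee (g x0) * (((1 / √(g2 x0) : ℝ):ℂ) * κ)‖
      ≤ 20 + 500 * C + 4 / (lam * δ) + 13 * l3 * δ ^ 4 := by
  have hab := hax.trans hxb
  have hCl : 0 < C * lam := by positivity
  have u1 := slope_upper h1 hlam' le_rfl hax hxb
  have u2 := slope_upper h1 hlam' hax hxb le_rfl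
  rw [hg, hga] at u1
  rw [hg, hgb] at u2
  have d1 : a ≤ x0 - δ := by
    by_contra hc; push Not at hc
    have : C * lam * (x0 - a) < C * lam * δ := by gcongr; linarith
    linarith
  have d2 : x0 + δ ≤ b := by
    by_contra hc; push Not at hc
    have : C * lam * (b - x0) < C * lam * δ := by gcongr; linarith
    linarith
  have A := lemmaA ha hab hCl.le h0 h1 (fun x hx => by
      rw [abs_of_nonneg (hl.le.trans (hlam x hx))]; exact hlam' x hx) (fun x hx => by
      have v1 := slope_lower h1 hlam le_rfl hx.1 hx.2
      have v2 := slope_lower h1 hlam hx.1 hx.2 le_rfl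
      rw [hga] at v1; rw [hgb] at v2
      have := mul_nonneg hl.le (sub_nonneg.mpr hx.1)
      have := mul_nonneg hl.le (sub_nonneg.mpr hx.2)
      exact abs_le.mpr ⟨by linarith, by linarith⟩)
  have v := slope_lower h1 hlam le_rfl hab le_rfl
  rw [hga, hgb] at v
  have B := statphase hκ hl hδ d1 d2 h0 h1 h2 h3 hlam hg
  have hC2 : C * lam * (b - a) ≤ C := by nlinarith
  set X := ∑ m ∈ Finset.Ioc ⌊a⌋₊ ⌊b⌋₊, ee (g m)
  set I := ∫ x in a..b, ee (g x)
  set Y := ee (g x0) * (((1 / √(g2 x0) : ℝ):ℂ) * κ)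
  calc ‖X - Y‖ = ‖(X - I) + (I - Y)‖ := by congr 1; ring
    _ ≤ _ := (norm_add_le _ _).trans (add_le_add A B)
    _ ≤ _ := by linarith


theorem diff1 {a b c C : ℝ} {f f' : ℝ → ℝ} (h : ∀ x ∈ Set.Icc a b, HasDerivAt f (f' x) x)
    (hc : ∀ x ∈ Set.Icc a b, c ≤ f' x ∧ f' x ≤ C) (x : ℝ) (hx : a ≤ x) (hx' : x + 1 ≤ b) :
    c ≤ f (x+1) - f x ∧ f (x+1) - f x ≤ C := by
  have h1 := slope_lower h (fun x hx => (hc x hx).1) hx (show x ≤ x + 1 by linarith) hx'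
  have h2 := slope_upper h (fun x hx => (hc x hx).2) hx (show x ≤ x + 1 by linarith) hx'
  constructor <;> linarith

theorem shiftd {a b : ℝ} {f f' : ℝ → ℝ} (h : ∀ x ∈ Set.Icc a b, HasDerivAt f (f' x) x) :
    ∀ x ∈ Set.Icc a (b-1), HasDerivAt (fun x => f (x+1) - f x) (f' (x+1) - f' x) x := by
  intro x hx
  exact ((h (x+1) ⟨by linarith [hx.1], by linarith [hx.2]⟩).comp_add_const x 1).sub
    (h x ⟨by linarith [hx.1], by linarith [hx.2]⟩)

theorem diff2 {a b c C : ℝ} {f f1 f2 : ℝ → ℝ} (h : ∀ x ∈ Set.Icc a b, HasDerivAt f (f1 x) x)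
    (h1 : ∀ x ∈ Set.Icc a b, HasDerivAt f1 (f2 x) x)
    (hc : ∀ x ∈ Set.Icc a b, c ≤ f2 x ∧ f2 x ≤ C) (x : ℝ) (hx : a ≤ x) (hx' : x + 2 ≤ b) :
    c ≤ f (x+2) - 2 * f (x+1) + f x ∧ f (x+2) - 2 * f (x+1) + f x ≤ C := by
  have := diff1 (shiftd h) (fun x hx => diff1 h1 hc x hx.1 (by linarith [hx.2])) x hx (by linarith)
  rw [show x + 1 + 1 = x + 2 by ring] at this
  constructor <;> linarith [this.1, this.2]

theorem diff3 {a b c C : ℝ} {f f1 f2 f3 : ℝ → ℝ} (h : ∀ x ∈ Set.Icc a b, HasDerivAt f (f1 x) x)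
    (h1 : ∀ x ∈ Set.Icc a b, HasDerivAt f1 (f2 x) x)
    (h2 : ∀ x ∈ Set.Icc a b, HasDerivAt f2 (f3 x) x)
    (hc : ∀ x ∈ Set.Icc a b, c ≤ f3 x ∧ f3 x ≤ C) (x : ℝ) (hx : a ≤ x) (hx' : x + 3 ≤ b) :
    c ≤ f (x+3) - 3 * f (x+2) + 3 * f (x+1) - f x ∧ f (x+3) - 3 * f (x+2) + 3 * f (x+1) - f x ≤ C := by
  have := diff2 (shiftd h) (shiftd h1) (fun x hx => diff1 h2 hc x hx.1 (by linarith [hx.2])) x hx (by linarith)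
  rw [show x + 1 + 1 = x + 2 by ring, show x + 2 + 1 = x + 3 by ring] at this
  constructor <;> linarith [this.1, this.2]

theorem diff4 {a b c C : ℝ} {f f1 f2 f3 f4 : ℝ → ℝ} (h : ∀ x ∈ Set.Icc a b, HasDerivAt f (f1 x) x)
    (h1 : ∀ x ∈ Set.Icc a b, HasDerivAt f1 (f2 x) x)
    (h2 : ∀ x ∈ Set.Icc a b, HasDerivAt f2 (f3 x) x)
    (h3 : ∀ x ∈ Set.Icc a b, HasDerivAt f3 (f4 x) x)
    (hc : ∀ x ∈ Set.Icc a b, c ≤ f4 x ∧ f4 x ≤ C) (x : ℝ) (hx : a ≤ x) (hx' : x + 4 ≤ b) :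
    c ≤ f (x+4) - 4 * f (x+3) + 6 * f (x+2) - 4 * f (x+1) + f x ∧
      f (x+4) - 4 * f (x+3) + 6 * f (x+2) - 4 * f (x+1) + f x ≤ C := by
  have := diff3 (shiftd h) (shiftd h1) (shiftd h2) (fun x hx => diff1 h3 hc x hx.1 (by linarith [hx.2])) x hx (by linarith)
  rw [show x + 1 + 1 = x + 2 by ring, show x + 2 + 1 = x + 3 by ring, show x + 3 + 1 = x + 4 by ring] at this
  constructor <;> linarith [this.1, this.2]

noncomputable def fF (T h x : ℝ) : ℝ := T * (Real.log (x + h) - Real.log (x - h))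
noncomputable def fF1 (T h x : ℝ) : ℝ := - (2 * (h * T)) / (x ^ 2 - h ^ 2)
noncomputable def fF2 (T h x : ℝ) : ℝ := 4 * (h * T) * x / (x ^ 2 - h ^ 2) ^ 2
noncomputable def fF3 (T h x : ℝ) : ℝ := - (4 * (h * T) * (3 * x ^ 2 + h ^ 2) / (x ^ 2 - h ^ 2) ^ 3)

theorem sq_pos {h x : ℝ} (hh : 0 < h) (hx : h < x) : 0 < x ^ 2 - h ^ 2 := by nlinarith

theorem fF_d {T h x : ℝ} (hh : 0 < h) (hx : h < x) : HasDerivAt (fF T h) (fF1 T h x) x := by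
  have hp := sq_pos hh hx
  have h1 := ((hasDerivAt_id x).add_const h).log (by simp; linarith)
  have h2 := ((hasDerivAt_id x).sub_const h).log (by simp; linarith)
  refine ((h1.sub h2).const_mul T).congr_deriv ?_
  unfold fF1
  have n1 : x + h ≠ 0 := by linarith
  have n2 : x - h ≠ 0 := by linarith
  have n3 : x ^ 2 - h ^ 2 ≠ 0 := hp.ne'
  simp only [id]
  rw [div_sub_div _ _ n1 n2, show (x + h) * (x - h) = x ^ 2 - h ^ 2 by ring]
  field_simp
  ring

theorem fF1_d {T h x : ℝ} (hh : 0 < h) (hx : h < x) : HasDerivAt (fF1 T h) (fF2 T h x) x := by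
  have hp := (sq_pos hh hx).ne'
  have h1 := (hasDerivAt_pow 2 x).sub_const (h ^ 2)
  refine ((hasDerivAt_const x (- (2 * (h * T)))).div h1 hp).congr_deriv ?_
  unfold fF2
  congr 1
  push_cast
  ring

theorem fF2_d {T h x : ℝ} (hh : 0 < h) (hx : h < x) : HasDerivAt (fF2 T h) (fF3 T h x) x := by
  have hp := (sq_pos hh hx).ne'
  have h1 := ((hasDerivAt_pow 2 x).sub_const (h ^ 2)).pow 2
  refine (((hasDerivAt_id x).const_mul (4 * (h * T))).div h1 (pow_ne_zero 2 hp)).congr_deriv ?_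
  unfold fF3
  simp only [id, Pi.pow_apply]
  push_cast
  field_simp
  ring

structure Hyp (T h M : ℝ) : Prop where
  T0 : 0 < T
  h1 : 1 ≤ h
  M0 : 16 < M
  hM : 4 * h ≤ M
  MT : M ^ 2 ≤ 2 * T

theorem u_bounds {T h M x : ℝ} (H : Hyp T h M) (hx : M / 2 ≤ x) (hx' : x ≤ 5 * M / 4) :
    3 * M ^ 2 / 16 ≤ x ^ 2 - h ^ 2 ∧ x ^ 2 - h ^ 2 ≤ 25 * M ^ 2 / 16 := by
  obtain ⟨T0, h1, M0, hM, MT⟩ := H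
  constructor <;> nlinarith

theorem hlt {T h M x : ℝ} (H : Hyp T h M) (hx : M / 2 ≤ x) : h < x := by
  obtain ⟨T0, h1, M0, hM, MT⟩ := H; linarith

theorem f2_bounds {T h M x : ℝ} (H : Hyp T h M) (hx : M / 2 ≤ x) (hx' : x ≤ 5 * M / 4) :
    h * T / (2 * M ^ 3) ≤ fF2 T h x ∧ fF2 T h x ≤ 300 * (h * T / (2 * M ^ 3)) := by
  obtain ⟨u1, u2⟩ := u_bounds H hx hx'
  obtain ⟨T0, h1, M0, hM, MT⟩ := H
  have hq : 0 < h * T := by positivity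
  have hM0 : 0 < M := by linarith
  have hu : 0 < x ^ 2 - h ^ 2 := by nlinarith
  unfold fF2
  constructor
  · calc h * T / (2 * M ^ 3) ≤ 4 * (h * T) * (M / 2) / (25 * M ^ 2 / 16) ^ 2 := by
          rw [div_le_div_iff₀ (by positivity) (by positivity)]
          have : 0 < h * T * M ^ 4 := by positivity
          nlinarith
      _ ≤ _ := by
          have hx0 : 0 ≤ x := by linarith
          gcongr
  · have hx0 : 0 ≤ x := by linarith
    calc 4 * (h * T) * x / (x ^ 2 - h ^ 2) ^ 2 ≤ 4 * (h * T) * (5 * M / 4) / (3 * M ^ 2 / 16) ^ 2 := by gcongr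
      _ ≤ _ := by
          rw [← mul_div_assoc 300, div_le_div_iff₀ (by positivity) (by positivity)]
          have : 0 < h * T * M ^ 4 := by positivity
          nlinarith

theorem f3_bounds {T h M x : ℝ} (H : Hyp T h M) (hx : M / 2 ≤ x) (hx' : x ≤ 5 * M / 4) :
    h * T / (2 * M ^ 4) ≤ - fF3 T h x ∧ - fF3 T h x ≤ 6000 * (h * T / (2 * M ^ 4)) := by
  obtain ⟨u1, u2⟩ := u_bounds H hx hx'
  obtain ⟨T0, h1, M0, hM, MT⟩ := H
  have hq : 0 < h * T := by positivity
  have hM0 : 0 < M := by linarith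
  have hu : 0 < x ^ 2 - h ^ 2 := by nlinarith
  unfold fF3
  rw [neg_neg]
  constructor
  · calc h * T / (2 * M ^ 4) ≤ 4 * (h * T) * (3 * (M / 2) ^ 2 + 0) / (25 * M ^ 2 / 16) ^ 3 := by
          rw [div_le_div_iff₀ (by positivity) (by positivity)]
          have : 0 < h * T * M ^ 6 := by positivity
          nlinarith
      _ ≤ _ := by gcongr; positivity
  · have hx0 : 0 ≤ x := by linarith
    calc 4 * (h * T) * (3 * x ^ 2 + h ^ 2) / (x ^ 2 - h ^ 2) ^ 3 ≤ 4 * (h * T) * (3 * (5 * M / 4) ^ 2 + (M / 4) ^ 2) / (3 * M ^ 2 / 16) ^ 3 := by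
          gcongr; linarith
      _ ≤ _ := by
          rw [← mul_div_assoc 6000, div_le_div_iff₀ (by positivity) (by positivity)]
          have : 0 < h * T * M ^ 6 := by positivity
          nlinarith

noncomputable def XX (T h s : ℝ) : ℝ := √(h ^ 2 + 2 * (h * T) / s)
noncomputable def XX1 (T h s : ℝ) : ℝ := - ((h * T) / (s ^ 2 * XX T h s))
noncomputable def XX2 (T h s : ℝ) : ℝ := 2 * (h * T) / (s ^ 3 * XX T h s) - (h * T) ^ 2 / (s ^ 4 * XX T h s ^ 3)
noncomputable def XX3 (T h s : ℝ) : ℝ := - (6 * (h * T) / (s ^ 4 * XX T h s)) + 6 * (h * T) ^ 2 / (s ^ 5 * XX T h s ^ 3)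
  - 3 * (h * T) ^ 3 / (s ^ 6 * XX T h s ^ 5)
noncomputable def fs (T h s : ℝ) : ℝ := fF T h (XX T h s) + s * XX T h s

theorem XX_sq {T h s : ℝ} (hT : 0 < T) (hh : 0 < h) (hs : 0 < s) : XX T h s ^ 2 = h ^ 2 + 2 * (h * T) / s :=
  Real.sq_sqrt (by positivity)

theorem XX_gt {T h s : ℝ} (hT : 0 < T) (hh : 0 < h) (hs : 0 < s) : h < XX T h s := by
  refine Real.lt_sqrt_of_sq_lt ?_
  have : 0 < 2 * (h * T) / s := by positivity
  linarith

theorem XX_pos {T h s : ℝ} (hT : 0 < T) (hh : 0 < h) (hs : 0 < s) : 0 < XX T h s := hh.trans (XX_gt hT hh hs)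

theorem fF1_XX {T h s : ℝ} (hT : 0 < T) (hh : 0 < h) (hs : 0 < s) : fF1 T h (XX T h s) = - s := by
  unfold fF1
  rw [XX_sq hT hh hs]
  have : h * T ≠ 0 := by positivity
  field_simp
  ring

theorem fF2_XX {T h s : ℝ} (hT : 0 < T) (hh : 0 < h) (hs : 0 < s) : fF2 T h (XX T h s) = XX T h s * s ^ 2 / (h * T) := by
  unfold fF2
  rw [XX_sq hT hh hs]
  have : h * T ≠ 0 := by positivity
  field_simp
  ring

theorem XX_d {T h s : ℝ} (hT : 0 < T) (hh : 0 < h) (hs : 0 < s) : HasDerivAt (XX T h) (XX1 T h s) s := by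
  have h1 := ((hasDerivAt_inv hs.ne').const_mul (2 * (h * T))).const_add (h ^ 2)
  have h2 := h1.sqrt (by positivity)
  have e : XX T h = fun s => √(h ^ 2 + 2 * (h * T) * s⁻¹) := by
    funext s; unfold XX; rw [div_eq_mul_inv]
  have hX := XX_pos hT hh hs
  have e2 : √(h ^ 2 + 2 * (h * T) * s⁻¹) = XX T h s := by rw [e]
  rw [e2] at h2
  rw [e]
  refine h2.congr_deriv ?_
  unfold XX1
  field_simp

theorem XX1_d {T h s : ℝ} (hT : 0 < T) (hh : 0 < h) (hs : 0 < s) : HasDerivAt (XX1 T h) (XX2 T h s) s := by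
  have hX := XX_pos hT hh hs
  have h1 := (hasDerivAt_pow 2 s).mul (XX_d hT hh hs)
  have h2 := ((hasDerivAt_const s (h * T)).div h1 (ne_of_gt (by simp only [Pi.mul_apply]; positivity))).neg
  refine h2.congr_deriv ?_
  unfold XX2 XX1
  simp only [Pi.mul_apply]
  push_cast
  field_simp
  ring

theorem XX2_d {T h s : ℝ} (hT : 0 < T) (hh : 0 < h) (hs : 0 < s) : HasDerivAt (XX2 T h) (XX3 T h s) s := by
  have hX := XX_pos hT hh hs
  have h1 := (hasDerivAt_pow 3 s).mul (XX_d hT hh hs)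
  have h1' := (hasDerivAt_pow 4 s).mul ((XX_d hT hh hs).pow 3)
  have h2 := ((hasDerivAt_const s (2 * (h * T))).div h1 (ne_of_gt (by simp only [Pi.mul_apply]; positivity))).sub
    ((hasDerivAt_const s ((h * T) ^ 2)).div h1' (ne_of_gt (by simp only [Pi.mul_apply, Pi.pow_apply]; positivity)))
  refine h2.congr_deriv ?_
  unfold XX3 XX1
  simp only [Pi.mul_apply, Pi.pow_apply]
  push_cast
  field_simp
  ring

theorem fs_d {T h s : ℝ} (hT : 0 < T) (hh : 0 < h) (hs : 0 < s) : HasDerivAt (fs T h) (XX T h s) s := by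
  have h1 := (fF_d (T := T) hh (XX_gt hT hh hs)).comp s (XX_d hT hh hs)
  have h2 := (hasDerivAt_id s).mul (XX_d hT hh hs)
  refine (h1.add h2).congr_deriv ?_
  rw [fF1_XX hT hh hs]
  simp

theorem XX3_eq {T h s : ℝ} (hT : 0 < T) (hh : 0 < h) (hs : 0 < s) :
    - XX3 T h s = (2 * (h * T)) / (s ^ 4 * XX T h s) *
      (3 - 3/2 * ((2 * (h * T)) / (s * XX T h s ^ 2)) + 3/8 * ((2 * (h * T)) / (s * XX T h s ^ 2)) ^ 2) := by
  have hX := XX_pos hT hh hs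
  unfold XX3
  field_simp
  ring

theorem XX3_bounds {T h M s : ℝ} (H : Hyp T h M) (hs1 : 2 * (h * T) / M ^ 2 ≤ s) (hs2 : s ≤ 19 * (h * T) / M ^ 2) :
    M ^ 7 / (50000 * (h * T) ^ 3) ≤ - XX3 T h s ∧ - XX3 T h s ≤ 100000 * (M ^ 7 / (50000 * (h * T) ^ 3)) := by
  obtain ⟨T0, h1, M0, hM, MT⟩ := H
  have hh : 0 < h := by linarith
  have hM0 : 0 < M := by linarith
  have hq : 0 < h * T := by positivity
  have hs : 0 < s := lt_of_lt_of_le (by positivity) hs1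
  have hX := XX_pos T0 hh hs
  have hX2 := XX_sq T0 hh hs
  have a1 : 2 * (h * T) / s ≤ M ^ 2 := by
    rw [div_le_iff₀ (by positivity)] at hs1
    rw [div_le_iff₀ hs]; linarith
  have a2 : 2 * M ^ 2 / 19 ≤ 2 * (h * T) / s := by
    rw [le_div_iff₀ (by positivity)] at hs2
    rw [le_div_iff₀ hs]; linarith
  have hXu : XX T h s ≤ 11 * M / 10 := by
    refine abs_le_of_sq_le_sq' ?_ (by positivity) |>.2
    rw [hX2]; nlinarith
  have hXl : M / 4 ≤ XX T h s := by
    refine abs_le_of_sq_le_sq' ?_ hX.le |>.2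
    rw [hX2]; nlinarith
  rw [XX3_eq T0 hh hs]
  have r0 : 0 ≤ (2 * (h * T)) / (s * XX T h s ^ 2) := by positivity
  have r1 : (2 * (h * T)) / (s * XX T h s ^ 2) ≤ 1 := by
    rw [div_le_one (by positivity), hX2]
    have : s * (h ^ 2 + 2 * (h * T) / s) = s * h ^ 2 + 2 * (h * T) := by field_simp
    rw [this]
    have : 0 ≤ s * h ^ 2 := by positivity
    linarith
  set r := (2 * (h * T)) / (s * XX T h s ^ 2)
  set q := h * T
  have b1 : 3 / 2 ≤ 3 - 3/2 * r + 3/8 * r ^ 2 := by nlinarith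
  have b2 : 3 - 3/2 * r + 3/8 * r ^ 2 ≤ 3 := by nlinarith
  constructor
  · calc M ^ 7 / (50000 * q ^ 3) ≤ 2 * q / ((19 * q / M ^ 2) ^ 4 * (11 * M / 10)) * (3 / 2) := by
          have e : 2 * q / ((19 * q / M ^ 2) ^ 4 * (11 * M / 10)) * (3 / 2) = (30 / (130321 * 11)) * (M ^ 7 / q ^ 3) := by
            field_simp; norm_num
          have e2 : M ^ 7 / (50000 * q ^ 3) = (1 / 50000) * (M ^ 7 / q ^ 3) := by field_simp
          rw [e, e2]
          have : 0 < M ^ 7 / q ^ 3 := by positivity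
          exact mul_le_mul_of_nonneg_right (by norm_num) this.le
      _ ≤ _ := by gcongr
  · calc 2 * q / (s ^ 4 * XX T h s) * (3 - 3/2 * r + 3/8 * r ^ 2) ≤ 2 * q / ((2 * q / M ^ 2) ^ 4 * (M / 4)) * 3 := by gcongr
      _ = (3 / 2) * (M ^ 7 / q ^ 3) := by field_simp; norm_num
      _ ≤ 2 * (M ^ 7 / q ^ 3) := by
          have : 0 < M ^ 7 / q ^ 3 := by positivity
          linarith
      _ = _ := by field_simp; norm_num

theorem fF_eq {T h x : ℝ} (hh : 0 < h) (hx : h < x) : T * Real.log ((x + h) / (x - h)) = fF T h x := by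
  unfold fF
  rw [Real.log_div (by linarith) (by linarith)]

theorem XX_anti {T h s t : ℝ} (hT : 0 < T) (hh : 0 < h) (hs : 0 < s) (hst : s ≤ t) : XX T h t ≤ XX T h s := by
  unfold XX
  gcongr

theorem XX_inv {T h x : ℝ} (hT : 0 < T) (hh : 0 < h) (hx : h < x) : XX T h (- fF1 T h x) = x := by
  have := sq_pos hh hx
  unfold XX fF1
  have e : h ^ 2 + 2 * (h * T) / (- (- (2 * (h * T)) / (x ^ 2 - h ^ 2))) = x ^ 2 := by
    field_simp; ring
  rw [e, Real.sqrt_sq (by linarith)]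

theorem fF2_XX_mono {T h s t : ℝ} (hT : 0 < T) (hh : 0 < h) (hs : 0 < s) (hst : s ≤ t) :
    fF2 T h (XX T h s) ≤ fF2 T h (XX T h t) := by
  have ht : 0 < t := hs.trans_le hst
  rw [fF2_XX hT hh hs, fF2_XX hT hh ht]
  gcongr ?_ / _
  have e : ∀ s, 0 < s → XX T h s * s ^ 2 = √(h ^ 2 * s ^ 4 + 2 * (h * T) * s ^ 3) := by
    intro s hs
    unfold XX
    rw [show h ^ 2 * s ^ 4 + 2 * (h * T) * s ^ 3 = (h ^ 2 + 2 * (h * T) / s) * (s ^ 2) ^ 2 by field_simp,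
      Real.sqrt_mul (by positivity), Real.sqrt_sq (by positivity)]
  rw [e s hs, e t ht]
  gcongr


theorem sum_Ioc_range (p q : ℕ) (F : ℕ → ℂ) :
    ∑ m ∈ Finset.Ioc p q, F m = ∑ n ∈ Finset.range (q - p), F (p + 1 + n) := by
  have es : Finset.Ioc p q = Finset.Ico (p + 1) (q + 1) := by
    ext x; simp only [Finset.mem_Ioc, Finset.mem_Ico]; omega
  rw [es, Finset.sum_Ico_eq_sum_range]
  congr 2
  omega

theorem norm_sum_neg (s : Finset ℕ) (g : ℕ → ℝ) : ‖∑ n ∈ s, ee (- g n)‖ = ‖∑ n ∈ s, ee (g n)‖ := by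
  simp only [ee_neg]
  rw [← map_sum, Complex.norm_conj]

theorem six_root {y : ℝ} (hy : 0 < y) (n : ℕ) (hn : n ≠ 0) : ∃ x : ℝ, 0 < x ∧ x ^ n = y :=
  ⟨y ^ ((1:ℝ) / n), by positivity, by
    rw [← Real.rpow_natCast, ← Real.rpow_mul hy.le]
    have : (n:ℝ) ≠ 0 := by exact_mod_cast hn
    field_simp
    simp⟩

theorem case2 : ∃ C : ℝ, 1 ≤ C ∧ ∀ T h M D M₁ : ℝ, Hyp T h M → h ≤ D → D ^ 9 * T ^ 2 ≤ M ^ 7 →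
    M ^ 3 ≤ D ^ 2 * T → M / 2 ≤ M₁ → M₁ ≤ M →
    ‖∑ m ∈ Finset.Ioc ⌊M₁⌋₊ ⌊M⌋₊, ee (fF T h m)‖ ≤ C * (M / D) := by
  obtain ⟨A, hA, t3⟩ := test3 6000 (by norm_num)
  refine ⟨4 * A, by linarith, ?_⟩
  intro T h M D M₁ H hD hD9 hD2 hM1 hM1'
  have H' := H
  obtain ⟨T0, h1, M0, hM, MT⟩ := H'
  have hM0 : 0 < M := by linarith
  have hD1 : 1 ≤ D := h1.trans hD
  have hD0 : 0 < D := by linarith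
  have fa := Nat.lt_floor_add_one M₁
  have fa' := Nat.floor_le (show 0 ≤ M₁ by linarith)
  have fb' := Nat.floor_le (show 0 ≤ M by linarith)
  set p := ⌊M₁⌋₊
  set q := ⌊M⌋₊
  rw [sum_Ioc_range]
  obtain ⟨μ, hμ0, hμ6⟩ := six_root (show 0 < h * T / (2 * M ^ 4) by positivity) 6 (by norm_num)
  have hbound : ∀ x ∈ Set.Icc (M / 2) (5 * M / 4), h * T / (2 * M ^ 4) ≤ - fF3 T h x ∧ - fF3 T h x ≤ 6000 * (h * T / (2 * M ^ 4)) :=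
    fun x hx => f3_bounds H hx.1 hx.2
  have t := t3 μ hμ0 (fun n => - fF T h ((p + 1 + n : ℕ):ℝ)) (q - p) (by
    intro n hn
    have hpq : p + 1 + n ≤ q := by omega
    have hpq' : (p:ℝ) + 1 + n ≤ q := by exact_mod_cast hpq
    have hn0 : (0:ℝ) ≤ n := by positivity
    have := diff3 (f := fun x => - fF T h x) (f1 := fun x => - fF1 T h x) (f2 := fun x => - fF2 T h x)
      (f3 := fun x => - fF3 T h x) (a := M / 2) (b := 5 * M / 4)
      (fun x hx => (fF_d (by linarith) (hlt H hx.1)).neg) (fun x hx => (fF1_d (by linarith) (hlt H hx.1)).neg)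
      (fun x hx => (fF2_d (by linarith) (hlt H hx.1)).neg) hbound ((p + 1 + n : ℕ):ℝ) (by push_cast; linarith)
      (by push_cast; linarith)
    rw [hμ6]
    unfold D3
    push_cast at this ⊢
    simp only [add_assoc] at this ⊢
    exact this)
  rw [norm_sum_neg] at t
  refine t.trans ?_
  have hL : ((q - p : ℕ):ℝ) ≤ M := by
    have : ((q - p : ℕ):ℝ) ≤ q := by exact_mod_cast Nat.sub_le _ _
    linarith
  have hL2 : √((q - p : ℕ):ℝ) ≤ √M := Real.sqrt_le_sqrt hL
  -- exponents
  have x1 : D ^ 7 * T ≤ M ^ 4 := by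
    have : (D ^ 7 * T) * M ^ 3 ≤ M ^ 4 * M ^ 3 := by
      calc (D ^ 7 * T) * M ^ 3 ≤ (D ^ 7 * T) * (D ^ 2 * T) := by gcongr
        _ = D ^ 9 * T ^ 2 := by ring
        _ ≤ M ^ 7 := hD9
        _ = _ := by ring
    exact le_of_mul_le_mul_right this (by positivity)
  have x2 : D ^ 5 ≤ M := by
    have : D ^ 5 * M ^ 6 ≤ M * M ^ 6 := by
      calc D ^ 5 * M ^ 6 = D ^ 5 * (M ^ 3) ^ 2 := by ring
        _ ≤ D ^ 5 * (D ^ 2 * T) ^ 2 := by gcongr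
        _ = D ^ 9 * T ^ 2 := by ring
        _ ≤ M ^ 7 := hD9
        _ = _ := by ring
    exact le_of_mul_le_mul_right this (by positivity)
  have x3 : D ^ 6 * M ≤ T := by
    have : (D ^ 6 * M) * D ^ 2 ≤ T * D ^ 2 := by
      calc (D ^ 6 * M) * D ^ 2 = D ^ 8 * M := by ring
        _ ≤ D ^ 10 * M := by gcongr <;> norm_num [hD1]
        _ = (D ^ 5) ^ 2 * M := by ring
        _ ≤ M ^ 2 * M := by gcongr
        _ = M ^ 3 := by ring
        _ ≤ _ := by linarith
    exact le_of_mul_le_mul_right this (by positivity)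
  have y1 : μ * D ≤ 1 := by
    refine (pow_le_pow_iff_left₀ (by positivity) zero_le_one (show 6 ≠ 0 by norm_num)).mp ?_
    rw [mul_pow, hμ6, one_pow, div_mul_eq_mul_div, div_le_one (by positivity)]
    calc h * T * D ^ 6 ≤ D * T * D ^ 6 := by gcongr
      _ = D ^ 7 * T := by ring
      _ ≤ M ^ 4 := x1
      _ ≤ _ := by nlinarith [pow_pos hM0 4]
  have y2 : D ≤ 2 * (√M * μ) := by
    refine (pow_le_pow_iff_left₀ (by positivity) (by positivity) (show 6 ≠ 0 by norm_num)).mp ?_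
    rw [mul_pow, mul_pow, hμ6, show √M ^ 6 = (√M ^ 2) ^ 3 by ring, Real.sq_sqrt hM0.le]
    have e : 2 ^ 6 * (M ^ 3 * (h * T / (2 * M ^ 4))) = 32 * (h * T) / M := by field_simp; norm_num
    rw [e, le_div_iff₀ hM0]
    nlinarith
  have z1 : ((q - p : ℕ):ℝ) * μ ≤ M / D := by
    rw [le_div_iff₀ hD0]
    calc ((q - p : ℕ):ℝ) * μ * D = ((q - p : ℕ):ℝ) * (μ * D) := by ring
      _ ≤ M * 1 := by gcongr
      _ = M := by ring
  have z2 : √((q - p : ℕ):ℝ) / μ ≤ 2 * (M / D) := by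
    rw [← mul_div_assoc, div_le_div_iff₀ hμ0 hD0]
    calc √((q - p : ℕ):ℝ) * D ≤ √M * (2 * (√M * μ)) := by gcongr
      _ = 2 * (√M * √M) * μ := by ring
      _ = _ := by rw [Real.mul_self_sqrt hM0.le]
  have : 0 ≤ M / D := by positivity
  calc A * (((q - p : ℕ):ℝ) * μ + √((q - p : ℕ):ℝ) / μ) ≤ A * (M / D + 2 * (M / D)) := by gcongr
    _ ≤ _ := by nlinarith

theorem piece {T h M D a b : ℝ} (H : Hyp T h M) (hD : h ≤ D) (hD2 : D ^ 2 * T ≤ M ^ 3) (ha : M / 2 ≤ a) (hab : a ≤ b)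
    (hb : b ≤ M) (hv : fF1 T h b - fF1 T h a ≤ 2) :
    ‖∑ m ∈ Finset.Ioc ⌊a⌋₊ ⌊b⌋₊, ee (fF T h m)‖ ≤ 1000000 * (M / D) := by
  have H' := H
  obtain ⟨T0, h1, M0, hM, MT⟩ := H'
  have hM0 : 0 < M := by linarith
  have hD1 : 1 ≤ D := h1.trans hD
  have hD0 : 0 < D := by linarith
  have fa := Nat.lt_floor_add_one a
  have fb' := Nat.floor_le (show 0 ≤ b by linarith)
  set lam := h * T / (2 * M ^ 3) with hlam
  have hl0 : 0 < lam := by positivity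
  have hbd : ∀ x ∈ Set.Icc (M / 2) (5 * M / 4), lam ≤ fF2 T h x ∧ fF2 T h x ≤ 300 * lam :=
    fun x hx => f2_bounds H hx.1 hx.2
  have hlen : lam * (b - a) ≤ 2 := by
    refine le_trans ?_ hv
    exact slope_lower (a := M / 2) (b := 5 * M / 4) (fun x hx => fF1_d (by linarith) (hlt H hx.1))
      (fun x hx => (hbd x hx).1) ha hab (by linarith)
  set p := ⌊a⌋₊
  set q := ⌊b⌋₊
  rw [sum_Ioc_range]
  have t := test2 300 (by norm_num) lam hl0 (fun n => fF T h ((p + 1 + n : ℕ):ℝ)) (q - p) (by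
    intro n hn
    have hpq : p + 1 + n ≤ q := by omega
    have hpq' : (p:ℝ) + 1 + n ≤ q := by exact_mod_cast hpq
    have hn0 : (0:ℝ) ≤ n := by positivity
    have := diff2 (f := fun x => fF T h x) (f1 := fun x => fF1 T h x) (f2 := fun x => fF2 T h x)
      (a := M / 2) (b := 5 * M / 4)
      (fun x hx => (fF_d (by linarith) (hlt H hx.1))) (fun x hx => (fF1_d (by linarith) (hlt H hx.1)))
      hbd ((p + 1 + n : ℕ):ℝ) (by push_cast; linarith)
      (by push_cast; linarith)
    push_cast at this ⊢
    simp only [add_assoc] at this ⊢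
    exact this)
  refine t.trans ?_
  have hL : ((q - p : ℕ):ℝ) ≤ b - a + 1 := by
    rcases Nat.le_total p q with hpq | hpq
    · rw [Nat.cast_sub hpq]; linarith
    · rw [Nat.sub_eq_zero_of_le hpq]; simp; linarith
  have hs : 0 < √lam := Real.sqrt_pos.mpr hl0
  have hss : √lam * √lam = lam := Real.mul_self_sqrt hl0.le
  have hq1 : h * T ≤ M ^ 3 := by
    calc h * T ≤ D * T := by gcongr
      _ ≤ D ^ 2 * T := by gcongr; nlinarith
      _ ≤ _ := hD2
  have hlu : lam ≤ 1 := by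
    rw [hlam, div_le_one (by positivity)]
    have : 0 < M ^ 3 := by positivity
    linarith
  have hsu : √lam ≤ 1 := Real.sqrt_le_one.mpr hlu
  have hll : 1 / (4 * M) ≤ lam := by
    rw [hlam, div_le_div_iff₀ (by positivity) (by positivity)]
    have : 1 * T ≤ h * T := by gcongr
    nlinarith
  have hDM : D ^ 2 ≤ 2 * M := by
    have : D ^ 2 * M ^ 2 ≤ 2 * M * M ^ 2 := by
      calc D ^ 2 * M ^ 2 ≤ D ^ 2 * (2 * T) := by gcongr
        _ ≤ _ := by linarith
    exact le_of_mul_le_mul_right this (by positivity)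
  have hinv : 1 / √lam ≤ 3 * (M / D) := by
    rw [← mul_div_assoc, div_le_div_iff₀ hs hD0, one_mul]
    refine (pow_le_pow_iff_left₀ (by positivity) (by positivity) (show 2 ≠ 0 by norm_num)).mp ?_
    rw [mul_pow, Real.sq_sqrt hl0.le]
    have : (3 * M) ^ 2 * (1 / (4 * M)) = 9 / 4 * M := by field_simp; norm_num
    calc D ^ 2 ≤ 9 / 4 * M := by linarith
      _ = (3 * M) ^ 2 * (1 / (4 * M)) := this.symm
      _ ≤ _ := by gcongr
  have hmain : ((q - p : ℕ):ℝ) * √lam + 1 / √lam ≤ 4 * (1 / √lam) := by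
    have : ((q - p : ℕ):ℝ) * √lam ≤ 3 * (1 / √lam) := by
      rw [← mul_div_assoc, le_div_iff₀ hs, mul_assoc, hss]
      nlinarith
    linarith
  have : 0 ≤ M / D := by positivity
  calc 200 * 300 * (((q - p : ℕ):ℝ) * √lam + 1 / √lam) ≤ 200 * 300 * (4 * (3 * (M / D))) := by
        gcongr; linarith
    _ ≤ _ := by linarith

theorem abel_bound (w : ℕ → ℝ) (hw : ∀ n, 0 ≤ w n) (hanti : Antitone w) (z : ℕ → ℂ) (B : ℝ) (L : ℕ)
    (hB : ∀ n ≤ L, ‖∑ i ∈ Finset.range n, z i‖ ≤ B) :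
    ‖∑ i ∈ Finset.range L, z i * (w i : ℂ)‖ ≤ w 0 * B := by
  have key : ∀ n ≤ L, ‖(∑ i ∈ Finset.range n, z i * (w i : ℂ)) - (w n : ℂ) * ∑ i ∈ Finset.range n, z i‖ ≤ (w 0 - w n) * B := by
    intro n
    induction n with
    | zero => intro _; simp
    | succ n ih =>
      intro hn
      have e : (∑ i ∈ Finset.range (n+1), z i * (w i : ℂ)) - (w (n+1) : ℂ) * ∑ i ∈ Finset.range (n+1), z i =
        ((∑ i ∈ Finset.range n, z i * (w i : ℂ)) - (w n : ℂ) * ∑ i ∈ Finset.range n, z i)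
        + ((w n - w (n+1) : ℝ) : ℂ) * ∑ i ∈ Finset.range (n+1), z i := by
        rw [Finset.sum_range_succ, Finset.sum_range_succ]; push_cast; ring
      rw [e]
      have h1 : 0 ≤ w n - w (n+1) := sub_nonneg.mpr (hanti (Nat.le_succ n))
      refine (norm_add_le _ _).trans ?_
      rw [norm_mul, Complex.norm_real, Real.norm_eq_abs, abs_of_nonneg h1]
      have := ih (by omega)
      have := mul_le_mul_of_nonneg_left (hB (n+1) hn) h1
      nlinarith
  have k := key L le_rfl
  calc _ = ‖((∑ i ∈ Finset.range L, z i * (w i : ℂ)) - (w L : ℂ) * ∑ i ∈ Finset.range L, z i) + (w L : ℂ) * ∑ i ∈ Finset.range L, z i‖ := by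
        congr 1; ring
    _ ≤ (w 0 - w L) * B + w L * B := by
        refine (norm_add_le _ _).trans (add_le_add k ?_)
        rw [norm_mul, Complex.norm_real, Real.norm_eq_abs, abs_of_nonneg (hw L)]
        exact mul_le_mul_of_nonneg_left (hB L le_rfl) (hw L)
    _ = _ := by ring


theorem blockj {κ : ℂ} (hκ : ∀ R : ℝ, 0 < R → ‖fres R - κ‖ ≤ 2 / R) {T h M D : ℝ} (H : Hyp T h M) (hD : h ≤ D)
    (hD2 : D ^ 2 * T ≤ M ^ 3) (j : ℕ) (hj : 1 ≤ j) (hlo : M / 2 ≤ XX T h (j + 1/2)) (hhi : XX T h (j - 1/2) ≤ M) :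
    ‖(∑ m ∈ Finset.Ioc ⌊XX T h (j + 1/2)⌋₊ ⌊XX T h (j - 1/2)⌋₊, ee (fF T h m)) -
      ee (fs T h j) * (((1 / √(fF2 T h (XX T h j)) : ℝ):ℂ) * κ)‖
      ≤ 150020 + 2400 * (M ^ 3 / (h * T * D)) + h * T * D ^ 4 / M ^ 4 := by
  have H' := H
  obtain ⟨T0, h1, M0, hM, MT⟩ := H'
  have hM0 : 0 < M := by linarith
  have hh : 0 < h := by linarith
  have hD0 : 0 < D := by linarith
  have hj1 : (1:ℝ) ≤ j := by exact_mod_cast hj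
  have hq : 0 < h * T := by positivity
  have hd : 2 * 300 * (h * T / (2 * M ^ 3)) * (D / 300) ≤ 1 := by
    have e : 2 * 300 * (h * T / (2 * M ^ 3)) * (D / 300) = h * T * D / M ^ 3 := by field_simp
    rw [e, div_le_one (by positivity)]
    calc h * T * D ≤ D * T * D := by gcongr
      _ = D ^ 2 * T := by ring
      _ ≤ _ := hD2
  have hb5 : ∀ x ∈ Set.Icc (XX T h (j + 1/2)) (XX T h (j - 1/2)), M / 2 ≤ x ∧ x ≤ 5 * M / 4 :=
    fun x hx => ⟨hlo.trans hx.1, by linarith [hx.2]⟩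
  have b := block hκ (a := XX T h (j + 1/2)) (b := XX T h (j - 1/2)) (x0 := XX T h j) (δ := D / 300)
    (lam := h * T / (2 * M ^ 3)) (l3 := 6000 * (h * T / (2 * M ^ 4))) (C := 300)
    (by linarith) (XX_anti T0 hh (by linarith) (by linarith)) (XX_anti T0 hh (by linarith) (by linarith)) (by norm_num)
    (by positivity) (by positivity) hd (g := fun x => fF T h x + j * x) (g1 := fun x => fF1 T h x + j)
    (g2 := fF2 T h) (g3 := fF3 T h)
    (fun x hx => ((fF_d hh (hlt H (hb5 x hx).1)).add ((hasDerivAt_id x).const_mul (j:ℝ))).congr_deriv (by simp))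
    (fun x hx => (fF1_d hh (hlt H (hb5 x hx).1)).add_const _)
    (fun x hx => (fF2_d hh (hlt H (hb5 x hx).1)))
    (fun x hx => by
      have := f3_bounds H (hb5 x hx).1 (hb5 x hx).2
      have p : 0 < h * T / (2 * M ^ 4) := by positivity
      rw [abs_le]; constructor <;> linarith)
    (fun x hx => (f2_bounds H (hb5 x hx).1 (hb5 x hx).2).1)
    (fun x hx => (f2_bounds H (hb5 x hx).1 (hb5 x hx).2).2)
    (by simp only [fF1_XX T0 hh (show (0:ℝ) < j by linarith)]; ring)
    (by simp only [fF1_XX T0 hh (show (0:ℝ) < j + 1/2 by linarith)]; ring)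
    (by simp only [fF1_XX T0 hh (show (0:ℝ) < j - 1/2 by linarith)]; ring)
  have es : ∀ m : ℕ, ee (fF T h m + j * m) = ee (fF T h m) := by
    intro m
    have := ee_add_int (fF T h m) ((j * m : ℕ) : ℤ)
    push_cast at this
    exact this
  simp only [es] at b
  refine b.trans ?_
  have e1 : 4 / (h * T / (2 * M ^ 3) * (D / 300)) = 2400 * (M ^ 3 / (h * T * D)) := by field_simp; norm_num
  have e2 : 13 * (6000 * (h * T / (2 * M ^ 4))) * (D / 300) ^ 4 = 13 * 3000 / 300 ^ 4 * (h * T * D ^ 4 / M ^ 4) := by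
    field_simp; norm_num
  rw [e1, e2]
  have : 0 ≤ h * T * D ^ 4 / M ^ 4 := by positivity
  norm_num
  linarith

theorem tele (c : ℕ → ℕ) (F : ℕ → ℂ) (L : ℕ) (hc : ∀ i, i < L → c (i+1) ≤ c i) :
    ∑ i ∈ Finset.range L, ∑ m ∈ Finset.Ioc (c (i+1)) (c i), F m = ∑ m ∈ Finset.Ioc (c L) (c 0), F m ∧ c L ≤ c 0 := by
  induction L with
  | zero => simp
  | succ n ih =>
    obtain ⟨i1, i2⟩ := ih (fun i hi => hc i (by omega))
    have h3 := hc n (by omega)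
    refine ⟨?_, h3.trans i2⟩
    rw [Finset.sum_range_succ, i1, add_comm]
    exact Finset.sum_Ioc_consecutive F h3 i2

theorem errsum {T h M D : ℝ} (H : Hyp T h M) (hD : h ≤ D)
    (hD2 : D ^ 2 * T ≤ M ^ 3) (hD9 : D ^ 9 * T ^ 2 ≤ M ^ 7) :
    h * T / M ^ 2 * (150020 + 2400 * (M ^ 3 / (h * T * D)) + h * T * D ^ 4 / M ^ 4) ≤ 152421 * (M / D) := by
  obtain ⟨T0, h1, M0, hM, MT⟩ := H
  have hM0 : 0 < M := by linarith
  have hh : 0 < h := by linarith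
  have hD1 : 1 ≤ D := by linarith
  have hD0 : 0 < D := by linarith
  have a1 : h * T / M ^ 2 ≤ M / D := by
    rw [div_le_div_iff₀ (by positivity) hD0]
    calc h * T * D ≤ D * T * D := by gcongr
      _ = D ^ 2 * T := by ring
      _ ≤ _ := by linarith
  have a2 : h * T / M ^ 2 * (M ^ 3 / (h * T * D)) = M / D := by field_simp
  have a3 : h * T / M ^ 2 * (h * T * D ^ 4 / M ^ 4) ≤ M / D := by
    rw [div_mul_div_comm, div_le_div_iff₀ (by positivity) hD0]
    calc h * T * (h * T * D ^ 4) * D ≤ D * T * (D * T * D ^ 4) * D := by gcongr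
      _ = D ^ 7 * T ^ 2 := by ring
      _ ≤ D ^ 9 * T ^ 2 := by gcongr <;> norm_num [hD1]
      _ ≤ M ^ 7 := hD9
      _ = _ := by ring
  calc h * T / M ^ 2 * (150020 + 2400 * (M ^ 3 / (h * T * D)) + h * T * D ^ 4 / M ^ 4)
      = 150020 * (h * T / M ^ 2) + 2400 * (h * T / M ^ 2 * (M ^ 3 / (h * T * D))) + h * T / M ^ 2 * (h * T * D ^ 4 / M ^ 4) := by ring
    _ ≤ 150020 * (M / D) + 2400 * (M / D) + M / D := by rw [a2]; gcongr
    _ = _ := by ring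

set_option maxHeartbeats 1000000 in
theorem mainterm : ∃ A : ℝ, 1 ≤ A ∧ ∀ T h M D : ℝ, Hyp T h M → h ≤ D → D ^ 9 * T ^ 2 ≤ M ^ 7 →
    D ^ 2 * T ≤ M ^ 3 → ∀ j0 L : ℕ, 2 * (h * T / M ^ 2) ≤ j0 → (L:ℝ) ≤ 11 * (h * T / M ^ 2) →
    (j0:ℝ) + L ≤ 13 * (h * T / M ^ 2) → M / 2 ≤ XX T h j0 → XX T h j0 ≤ M →
    ‖∑ i ∈ Finset.range L, ee (fs T h ((j0 + i : ℕ):ℝ)) * ((1 / √(fF2 T h (XX T h ((j0 + i : ℕ):ℝ))) : ℝ):ℂ)‖ ≤ A * (M / D) := by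
  obtain ⟨A, hA, t4⟩ := test4 100000 (by norm_num)
  refine ⟨200 * A, by linarith, ?_⟩
  intro T h M D H hD hD9 hD2 j0 L hj0 hL hjL hX1 hX2
  have H' := H
  obtain ⟨T0, h1, M0, hM, MT⟩ := H'
  have hM0 : 0 < M := by linarith
  have hh : 0 < h := by linarith
  have hD1 : 1 ≤ D := by linarith
  have hD0 : 0 < D := by linarith
  have hq : 0 < h * T := by positivity
  set R := h * T / M ^ 2 with hR
  have hR0 : 0 < R := by positivity
  have hRh : 1 / 2 ≤ R := by
    rw [hR, div_le_div_iff₀ (by norm_num) (by positivity)]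
    nlinarith
  have hRT : R * M ^ 2 ≤ D * T := by
    rw [hR, div_mul_cancel₀ _ (by positivity)]; gcongr
  have eq1 : h * T = R * M ^ 2 := by rw [hR]; field_simp
  have hj00 : (0:ℝ) < j0 := by linarith
  obtain ⟨ρ, hρ0, hρ⟩ := six_root (show 0 < M ^ 7 / (50000 * (h * T) ^ 3) by positivity) 14 (by norm_num)
  have hρ' : ρ ^ 14 = M / (50000 * R ^ 3) := by rw [hρ, eq1]; field_simp
  -- partial sums
  have ps : ∀ n ≤ L, ‖∑ i ∈ Finset.range n, ee (fs T h ((j0 + i : ℕ):ℝ))‖ ≤ A * (11 * R * ρ + 7 * (√R * √√R) / ρ) := by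
    intro n hn
    have t := t4 ρ hρ0 (fun i => - fs T h ((j0 + i : ℕ):ℝ)) n (by
      intro i hi
      have hi1 : (i:ℝ) + 1 ≤ n := by exact_mod_cast hi
      have hi2 : (n:ℝ) ≤ L := by exact_mod_cast hn
      have hi0 : (0:ℝ) ≤ i := by positivity
      have sp : ∀ s ∈ Set.Icc (2 * R) (19 * R), 0 < s := fun s hs => by linarith [hs.1]
      have := diff4 (f := fun x => - fs T h x) (f1 := fun x => - XX T h x) (f2 := fun x => - XX1 T h x)
        (f3 := fun x => - XX2 T h x) (f4 := fun x => - XX3 T h x) (a := 2 * R) (b := 19 * R)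
        (fun x hx => (fs_d T0 hh (sp x hx)).neg) (fun x hx => (XX_d T0 hh (sp x hx)).neg)
        (fun x hx => (XX1_d T0 hh (sp x hx)).neg) (fun x hx => (XX2_d T0 hh (sp x hx)).neg)
        (fun x hx => XX3_bounds H (by rw [mul_div_assoc]; exact hx.1) (by rw [mul_div_assoc]; exact hx.2))
        ((j0 + i : ℕ):ℝ) (by push_cast; linarith) (by push_cast; linarith)
      rw [hρ]
      unfold D4
      push_cast at this ⊢
      simp only [add_assoc] at this ⊢
      exact this)
    rw [norm_sum_neg] at t
    refine t.trans ?_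
    have hn1 : (n:ℝ) ≤ 11 * R := le_trans (by exact_mod_cast hn) hL
    have hs1 : √((n:ℝ) * √n) ≤ 7 * (√R * √√R) := by
      rw [Real.sqrt_mul (by positivity)]
      have e1 : √(n:ℝ) ≤ 7 / 2 * √R := by
        refine Real.sqrt_le_iff.mpr ⟨by positivity, ?_⟩
        rw [mul_pow, Real.sq_sqrt hR0.le]; linarith
      have e2 : √√(n:ℝ) ≤ 2 * √√R := by
        refine Real.sqrt_le_iff.mpr ⟨by positivity, ?_⟩
        rw [mul_pow, Real.sq_sqrt (by positivity)]; linarith [Real.sqrt_nonneg R]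
      calc √(n:ℝ) * √√(n:ℝ) ≤ (7 / 2 * √R) * (2 * √√R) := by gcongr
        _ = _ := by ring
    gcongr
  set w : ℕ → ℝ := fun i => 1 / √(fF2 T h (XX T h ((j0 + i : ℕ):ℝ))) with hw
  have hpos : ∀ s, 0 < s → 0 < fF2 T h (XX T h s) := by
    intro s hs; rw [fF2_XX T0 hh hs]; have := XX_pos T0 hh hs; positivity
  have hjp : ∀ i : ℕ, (0:ℝ) < ((j0 + i : ℕ):ℝ) := by
    intro i; push_cast; have : (0:ℝ) ≤ i := by positivity
    linarith
  have ab := abel_bound w (fun n => by simp only [hw]; positivity) (by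
    intro i k hik
    simp only [hw]
    refine one_div_le_one_div_of_le (Real.sqrt_pos.mpr (hpos _ (hjp i))) (Real.sqrt_le_sqrt ?_)
    exact fF2_XX_mono T0 hh (hjp i) (by push_cast; have : (i:ℝ) ≤ k := by exact_mod_cast hik
                                        linarith)) (fun i => ee (fs T h ((j0 + i : ℕ):ℝ))) _ L ps
  refine ab.trans ?_
  have hw0 : w 0 ≤ √(2 * M) / √R := by
    simp only [hw, add_zero]
    rw [← Real.sqrt_div' _ hR0.le]
    have l := (f2_bounds H hX1 (by linarith)).1
    have l' : 1 / √(fF2 T h (XX T h j0)) ≤ 1 / √(h * T / (2 * M ^ 3)) :=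
      one_div_le_one_div_of_le (Real.sqrt_pos.mpr (by positivity)) (Real.sqrt_le_sqrt l)
    refine l'.trans_eq ?_
    rw [one_div, ← Real.sqrt_inv]
    congr 1
    rw [eq1]; field_simp
  have hw00 : 0 ≤ w 0 := by simp only [hw]; positivity
  have hsR : √R ^ 2 = R := Real.sq_sqrt hR0.le
  have hsM : √M ^ 2 = M := Real.sq_sqrt hM0.le
  have hsR0 : 0 < √R := Real.sqrt_pos.mpr hR0
  have hsM0 : 0 < √M := Real.sqrt_pos.mpr hM0
  -- exponents
  have x1 : R ^ 4 * D ^ 14 ≤ M ^ 6 := by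
    have : (R ^ 4 * D ^ 14) * M ^ 8 ≤ M ^ 6 * M ^ 8 := by
      calc (R ^ 4 * D ^ 14) * M ^ 8 = (R * M ^ 2) ^ 4 * D ^ 14 := by ring
        _ ≤ (D * T) ^ 4 * D ^ 14 := by gcongr
        _ = (D ^ 9 * T ^ 2) ^ 2 := by ring
        _ ≤ (M ^ 7) ^ 2 := by gcongr
        _ = _ := by ring
    exact le_of_mul_le_mul_right this (by positivity)
  have x2 : R ^ 13 * D ^ 28 ≤ M ^ 16 := by
    have : (R ^ 13 * D ^ 28) * M ^ 26 ≤ M ^ 16 * M ^ 26 := by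
      calc (R ^ 13 * D ^ 28) * M ^ 26 = (R * M ^ 2) ^ 13 * D ^ 28 := by ring
        _ ≤ (D * T) ^ 13 * D ^ 28 := by gcongr
        _ = (D ^ 2 * T) ^ 7 * (D ^ 9 * T ^ 2) ^ 3 := by ring
        _ ≤ (M ^ 3) ^ 7 * (M ^ 7) ^ 3 := by gcongr
        _ = _ := by ring
    exact le_of_mul_le_mul_right this (by positivity)
  have y1 : D * √R * ρ ≤ √M := by
    refine (pow_le_pow_iff_left₀ (by positivity) (by positivity) (show 14 ≠ 0 by norm_num)).mp ?_
    rw [mul_pow, mul_pow, hρ', show √R ^ 14 = (√R ^ 2) ^ 7 by ring, show √M ^ 14 = (√M ^ 2) ^ 7 by ring, hsR, hsM]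
    have e : D ^ 14 * R ^ 7 * (M / (50000 * R ^ 3)) = (R ^ 4 * D ^ 14) * M / 50000 := by field_simp
    rw [e]
    have : (R ^ 4 * D ^ 14) * M ≤ M ^ 6 * M := by gcongr
    have : 0 < M ^ 7 := by positivity
    nlinarith
  have y2 : D * √√R ≤ 3 * (ρ * √M) := by
    refine (pow_le_pow_iff_left₀ (by positivity) (by positivity) (show 28 ≠ 0 by norm_num)).mp ?_
    have e1 : √√R ^ 28 = R ^ 7 := by
      rw [show √√R ^ 28 = (√√R ^ 2) ^ 14 by ring, Real.sq_sqrt hsR0.le, show √R ^ 14 = (√R ^ 2) ^ 7 by ring, hsR]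
    rw [mul_pow, mul_pow, mul_pow, show ρ ^ 28 = (ρ ^ 14) ^ 2 by ring, hρ', show √M ^ 28 = (√M ^ 2) ^ 14 by ring, hsM, e1]
    have e : (3:ℝ) ^ 28 * ((M / (50000 * R ^ 3)) ^ 2 * M ^ 14) = (3 ^ 28 / 50000 ^ 2) * M ^ 16 / R ^ 6 := by
      field_simp
    rw [e, le_div_iff₀ (by positivity)]
    have : D ^ 28 * R ^ 7 * R ^ 6 = R ^ 13 * D ^ 28 := by ring
    rw [this]
    have : 0 < M ^ 16 := by positivity
    nlinarith
  have hs2 : √(2 * M) ≤ 2 * √M := by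
    refine Real.sqrt_le_iff.mpr ⟨by positivity, ?_⟩
    rw [mul_pow, hsM]; linarith
  have z1 : √R * ρ ≤ √M / D := by
    rw [le_div_iff₀ hD0]; linarith
  have z2 : √√R / ρ ≤ 3 * √M / D := by
    rw [div_le_div_iff₀ hρ0 hD0]; linarith
  calc w 0 * (A * (11 * R * ρ + 7 * (√R * √√R) / ρ))
      ≤ (2 * √M / √R) * (A * (11 * R * ρ + 7 * (√R * √√R) / ρ)) := by
        refine mul_le_mul_of_nonneg_right (hw0.trans ?_) (by positivity)
        gcongr
    _ = 2 * √M * A * (11 * (√R * ρ) + 7 * (√√R / ρ)) := by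
        nth_rewrite 2 [← hsR]; field_simp
    _ ≤ 2 * √M * A * (11 * (√M / D) + 7 * (3 * √M / D)) := by gcongr
    _ = 64 * A * (√M ^ 2 / D) := by ring
    _ ≤ _ := by
        rw [hsM]
        have : 0 ≤ A * (M / D) := by positivity
        nlinarith


theorem case1 : ∃ C : ℝ, 1 ≤ C ∧ ∀ T h M D M₁ : ℝ, Hyp T h M → h ≤ D → D ^ 9 * T ^ 2 ≤ M ^ 7 →
    D ^ 2 * T ≤ M ^ 3 → M / 2 ≤ M₁ → M₁ ≤ M →
    ‖∑ m ∈ Finset.Ioc ⌊M₁⌋₊ ⌊M⌋₊, ee (fF T h m)‖ ≤ C * (M / D) := by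
  obtain ⟨κ, hκ⟩ := fresnel
  obtain ⟨A, hA, mt⟩ := mainterm
  refine ⟨2000000 + 11 * 152421 + A * ‖κ‖, by have := norm_nonneg κ; nlinarith, ?_⟩
  intro T h M D M₁ H hD hD9 hD2 hM1 hM1'
  have H' := H
  obtain ⟨T0, h1, M0, hM, MT⟩ := H'
  have hM0 : 0 < M := by linarith
  have hh : 0 < h := by linarith
  have hD0 : 0 < D := by linarith
  have hMD : 0 < M / D := by positivity
  have hκA : 0 ≤ A * ‖κ‖ := by positivity
  have hMh : h < M := by linarith
  have hM1h : h < M₁ := by linarith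
  set R := h * T / M ^ 2 with hR
  have hR0 : 0 < R := by positivity
  have eq1 : h * T = R * M ^ 2 := by rw [hR]; field_simp
  have hRh : 1 / 2 ≤ R := by
    rw [hR, div_le_div_iff₀ (by norm_num) (by positivity)]
    nlinarith
  set slo := - fF1 T h M with hslo
  set shi := - fF1 T h M₁ with hshi
  have hlo : 2 * R ≤ slo := by
    have := sq_pos hh hMh
    rw [hslo]; unfold fF1
    rw [neg_div, neg_neg, eq1, le_div_iff₀ this]
    nlinarith [mul_pos hR0 (pow_pos hh 2)]
  have hhi : shi ≤ 11 * R := by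
    have := (u_bounds H hM1 (by linarith)).1
    have p := sq_pos hh hM1h
    rw [hshi]; unfold fF1
    rw [neg_div, neg_neg, eq1, div_le_iff₀ p]
    nlinarith
  have XM : XX T h slo = M := XX_inv T0 hh hMh
  have XM1 : XX T h shi = M₁ := XX_inv T0 hh hM1h
  by_cases hc : shi - slo ≤ 2
  · have := piece H hD hD2 hM1 hM1' le_rfl (by linarith)
    refine this.trans ?_
    gcongr
    linarith
  push Not at hc
  set j0 := ⌈slo + 1/2⌉₊ with hj0
  set j1 := ⌊shi - 1/2⌋₊ with hj1
  have c1 : slo + 1/2 ≤ j0 := Nat.le_ceil _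
  have c2 : (j0:ℝ) < slo + 1/2 + 1 := Nat.ceil_lt_add_one (by linarith)
  have c3 : (j1:ℝ) ≤ shi - 1/2 := Nat.floor_le (by linarith)
  have c4 : shi - 1/2 < (j1:ℝ) + 1 := Nat.lt_floor_add_one _
  have hj01 : j0 ≤ j1 + 1 := by
    have : (j0:ℝ) < j1 + 2 := by linarith
    have : j0 < j1 + 2 := by exact_mod_cast this
    omega
  obtain ⟨L, hL⟩ := Nat.exists_eq_add_of_le hj01
  have hLr : (j1:ℝ) + 1 = j0 + L := by exact_mod_cast hL
  have hj0' : 1 ≤ j0 := by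
    have : (0:ℝ) < j0 := by linarith
    exact_mod_cast this
  set c : ℕ → ℝ := fun i => XX T h ((j0 + i : ℕ) - 1/2) with hcdef
  have cpos : ∀ i : ℕ, (0:ℝ) < ((j0 + i : ℕ):ℝ) - 1/2 := by
    intro i; push_cast; have : (0:ℝ) ≤ i := by positivity
    linarith
  have canti : ∀ i k : ℕ, i ≤ k → c k ≤ c i := by
    intro i k hik
    refine XX_anti T0 hh (cpos i) ?_
    push_cast; have : (i:ℝ) ≤ k := by exact_mod_cast hik
    linarith
  have c0M : c 0 ≤ M := by
    rw [← XM]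
    refine XX_anti T0 hh (by linarith) ?_
    push_cast; linarith
  have cLM : M₁ ≤ c L := by
    rw [← XM1]
    refine XX_anti T0 hh (cpos L) ?_
    push_cast; linarith
  have cL0 : c L ≤ c 0 := canti 0 L (by omega)
  have fc : ∀ i, fF1 T h (c i) = - (((j0 + i : ℕ):ℝ) - 1/2) := fun i => fF1_XX T0 hh (cpos i)
  have p1 := piece H hD hD2 hM1 cLM (by linarith) (by rw [fc]; push_cast; linarith)
  have p2 := piece H hD hD2 (a := c 0) (b := M) (by linarith) c0M le_rfl (by rw [fc]; push_cast; linarith)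
  obtain ⟨te, te'⟩ := tele (fun i => ⌊c i⌋₊) (fun m => ee (fF T h m)) L
    (fun i hi => Nat.floor_le_floor (canti i (i+1) (by omega)))
  have split : ∑ m ∈ Finset.Ioc ⌊M₁⌋₊ ⌊M⌋₊, ee (fF T h m) = ∑ m ∈ Finset.Ioc ⌊M₁⌋₊ ⌊c L⌋₊, ee (fF T h m)
      + ∑ m ∈ Finset.Ioc ⌊c L⌋₊ ⌊c 0⌋₊, ee (fF T h m) + ∑ m ∈ Finset.Ioc ⌊c 0⌋₊ ⌊M⌋₊, ee (fF T h m) := by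
    rw [Finset.sum_Ioc_consecutive _ (Nat.floor_le_floor cLM) te',
      Finset.sum_Ioc_consecutive _ ((Nat.floor_le_floor cLM).trans te') (Nat.floor_le_floor c0M)]
  set E := 150020 + 2400 * (M ^ 3 / (h * T * D)) + h * T * D ^ 4 / M ^ 4 with hE
  have hE0 : 0 ≤ E := by positivity
  set mtm : ℕ → ℂ := fun i => ee (fs T h ((j0 + i : ℕ):ℝ)) * ((1 / √(fF2 T h (XX T h ((j0 + i : ℕ):ℝ))) : ℝ):ℂ) with hmtm
  have bl : ∀ i ∈ Finset.range L, ‖(∑ m ∈ Finset.Ioc ⌊c (i+1)⌋₊ ⌊c i⌋₊, ee (fF T h m)) - mtm i * κ‖ ≤ E := by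
    intro i hi
    have hi := Finset.mem_range.mp hi
    have e : XX T h (((j0 + i : ℕ):ℝ) + 1/2) = c (i+1) := by
      simp only [hcdef]; congr 1; push_cast; ring
    have b := blockj hκ H hD hD2 (j0 + i) (by omega)
      (by rw [e]; have := canti (i+1) L (by omega); linarith)
      (le_trans (canti 0 i (by omega)) c0M)
    rw [e] at b
    simp only [hmtm, mul_assoc]
    exact b
  have hL11 : (L:ℝ) ≤ 11 * R := by linarith
  have es := errsum H hD hD2 hD9
  rw [← hR, ← hE] at es
  have sumbl : ‖∑ i ∈ Finset.range L, ((∑ m ∈ Finset.Ioc ⌊c (i+1)⌋₊ ⌊c i⌋₊, ee (fF T h m)) - mtm i * κ)‖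
      ≤ 11 * 152421 * (M / D) := by
    refine (norm_sum_le_of_le _ bl).trans ?_
    rw [Finset.sum_const, Finset.card_range, nsmul_eq_mul]
    calc (L:ℝ) * E ≤ 11 * R * E := by gcongr
      _ = 11 * (R * E) := by ring
      _ ≤ 11 * (152421 * (M / D)) := by gcongr
      _ = _ := by ring
  rw [Finset.sum_sub_distrib, te, ← Finset.sum_mul] at sumbl
  have mtb : ‖∑ i ∈ Finset.range L, mtm i‖ ≤ A * (M / D) := by
    by_cases hL0 : L = 0
    · subst hL0; simp; positivity
    have hL1 : (1:ℝ) ≤ L := by exact_mod_cast Nat.one_le_iff_ne_zero.mpr hL0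
    refine mt T h M D H hD hD9 hD2 j0 L (by linarith) hL11 (by linarith) ?_ ?_
    · refine hM1.trans ?_
      rw [← XM1]
      exact XX_anti T0 hh (by linarith) (by linarith)
    · rw [← XM]
      exact XX_anti T0 hh (by linarith) (by linarith)
  have mid : ‖∑ m ∈ Finset.Ioc ⌊c L⌋₊ ⌊c 0⌋₊, ee (fF T h m)‖ ≤ 11 * 152421 * (M / D) + A * (M / D) * ‖κ‖ := by
    have := norm_sub_norm_le (∑ m ∈ Finset.Ioc ⌊c L⌋₊ ⌊c 0⌋₊, ee (fF T h m)) ((∑ i ∈ Finset.range L, mtm i) * κ)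
    have t2 : ‖(∑ i ∈ Finset.range L, mtm i) * κ‖ ≤ A * (M / D) * ‖κ‖ := by
      rw [norm_mul]; gcongr
    linarith
  rw [split]
  refine (norm_add₃_le).trans ?_
  linarith


theorem exp_half_bound {U : ℝ} (hU : 1 ≤ U) : (Real.exp (1/U) - 1) / 2 ≤ 1 / U := by
  have h0 : 0 < 1 / U := by positivity
  have h1 : 1 / U ≤ 1 := by rw [div_le_one (by linarith)]; exact hU
  have := Real.abs_exp_sub_one_le (x := 1 / U) (by rw [abs_of_pos h0]; exact h1)
  rw [abs_of_pos h0] at this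
  have := (abs_le.mp this).2
  linarith

theorem summand_eq {T : ℝ} {h m : ℕ} (hh : 0 < h) (hm : h < m) :
    Complex.exp (2 * Real.pi * T * Complex.I * Real.log (((m:ℝ) + h) / ((m:ℝ) - h))) = ee (fF T h m) := by
  rw [← fF_eq (by exact_mod_cast hh) (by exact_mod_cast hm)]
  unfold ee
  congr 1
  push_cast
  ring

theorem percase : ∃ C : ℝ, 1 ≤ C ∧ ∀ T h M D M₁ : ℝ, Hyp T h M → h ≤ D → D ^ 9 * T ^ 2 ≤ M ^ 7 →
    M / 2 ≤ M₁ → M₁ ≤ M →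
    ‖∑ m ∈ Finset.Ioc ⌊M₁⌋₊ ⌊M⌋₊, ee (fF T h m)‖ ≤ C * (M / D) := by
  obtain ⟨C1, h1, c1⟩ := case1
  obtain ⟨C2, h2, c2⟩ := case2
  refine ⟨C1 + C2, by linarith, ?_⟩
  intro T h M D M₁ H hD hD9 hM1 hM1'
  have hMD : 0 < M / D := by
    obtain ⟨T0, h1, M0, hM, MT⟩ := H
    exact div_pos (by linarith) (by linarith)
  rcases le_total (D ^ 2 * T) (M ^ 3) with hc | hc
  · exact (c1 T h M D M₁ H hD hD9 hc hM1 hM1').trans (by nlinarith)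
  · exact (c2 T h M D M₁ H hD hD9 hc hM1 hM1').trans (by nlinarith)

theorem lemma13_3 :
    ∃ C > (0:ℝ), ∀ U T M M₁ : ℝ,
      1 ≤ U → 0 < T → 1 ≤ M → M ≤ Real.sqrt (2 * T) → M/2 ≤ M₁ → M₁ ≤ M →
      ‖∑ h ∈ Finset.Ioc 0 ⌊min ((Real.exp (1/U) - 1) * M / 2) (U ^ ((7:ℝ)/2) / T)⌋₊,
          ∑ m ∈ (Finset.Ioc ⌊M₁⌋₊ ⌊M⌋₊).filter (fun m => h < m),
            Complex.exp (2 * Real.pi * T * Complex.I *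
              Real.log (((m:ℝ) + h) / ((m:ℝ) - h)))‖ ≤ C * M := by
  obtain ⟨C, hC, pc⟩ := percase
  refine ⟨C + 16, by linarith, ?_⟩
  intro U T M M₁ hU hT hM hMT hM1 hM1'
  set D := min ((Real.exp (1/U) - 1) * M / 2) (U ^ ((7:ℝ)/2) / T) with hDdef
  have hM0 : 0 < M := by linarith
  have hU0 : 0 < U := by linarith
  have hDM : D ≤ M / U := by
    refine (min_le_left _ _).trans ?_
    have := exp_half_bound hU
    calc (Real.exp (1/U) - 1) * M / 2 = (Real.exp (1/U) - 1) / 2 * M := by ring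
      _ ≤ 1 / U * M := by gcongr
      _ = _ := by ring
  have hDT : D * T ≤ U ^ ((7:ℝ)/2) := by
    rw [← le_div_iff₀ hT]; exact min_le_right _ _
  have hMT2 : M ^ 2 ≤ 2 * T := by
    have := pow_le_pow_left₀ hM0.le hMT 2
    rwa [Real.sq_sqrt (by linarith)] at this
  clear_value D
  by_cases hD1 : D < 1
  · rw [Nat.floor_eq_zero.mpr hD1]
    simp
    positivity
  push Not at hD1
  have hD0 : 0 < D := by linarith
  have hDM' : D ≤ M := hDM.trans (div_le_self hM0.le hU)
  have hUD : D * U ≤ M := by rwa [le_div_iff₀ hU0] at hDM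
  have hfl : (⌊D⌋₊ : ℝ) ≤ D := Nat.floor_le hD0.le
  have hD9 : D ^ 9 * T ^ 2 ≤ M ^ 7 := by
    have e : (U ^ ((7:ℝ)/2)) ^ 2 = U ^ 7 := by
      rw [← Real.rpow_natCast, ← Real.rpow_mul hU0.le]
      norm_num
    calc D ^ 9 * T ^ 2 = D ^ 7 * (D * T) ^ 2 := by ring
      _ ≤ D ^ 7 * (U ^ ((7:ℝ)/2)) ^ 2 := by gcongr
      _ = (D * U) ^ 7 := by rw [e]; ring
      _ ≤ M ^ 7 := by gcongr
  by_cases hM16 : M ≤ 16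
  · have hn : ∀ h ∈ Finset.Ioc 0 ⌊D⌋₊, ‖∑ m ∈ (Finset.Ioc ⌊M₁⌋₊ ⌊M⌋₊).filter (fun m => h < m),
            Complex.exp (2 * Real.pi * T * Complex.I *
              Real.log (((m:ℝ) + h) / ((m:ℝ) - h)))‖ ≤ M := by
      intro h hh
      refine (norm_sum_le_of_le (f := fun m : ℕ => Complex.exp (2 * Real.pi * T * Complex.I *
              Real.log (((m:ℝ) + h) / ((m:ℝ) - h)))) (n := fun _ => (1:ℝ)) _ ?_).trans ?_
      · intro m hm
        rw [summand_eq (Finset.mem_Ioc.mp hh).1 (Finset.mem_filter.mp hm).2, norm_ee]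
      · rw [Finset.sum_const, nsmul_eq_mul, mul_one]
        have c1 : ((Finset.Ioc ⌊M₁⌋₊ ⌊M⌋₊).filter (fun m => h < m)).card ≤ ⌊M⌋₊ := by
          refine (Finset.card_filter_le _ _).trans ?_
          rw [Nat.card_Ioc]; exact Nat.sub_le _ _
        have c2 : (⌊M⌋₊:ℝ) ≤ M := Nat.floor_le hM0.le
        exact le_trans (by exact_mod_cast c1) c2
    refine (norm_sum_le_of_le _ hn).trans ?_
    rw [Finset.sum_const, nsmul_eq_mul, Nat.card_Ioc, Nat.sub_zero]
    gcongr
    linarith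
  push Not at hM16
  have hD4 : 4 * D ≤ M := by
    by_contra hcon
    push Not at hcon
    have a1 : (M / 4) ^ 9 * (M ^ 2 / 2) ^ 2 ≤ M ^ 7 := by
      refine le_trans ?_ hD9
      gcongr <;> linarith
    have a2 : M ^ 7 * (M ^ 6 / (4 ^ 9 * 4)) ≤ M ^ 7 * 1 := by
      refine le_of_eq_of_le ?_ (a1.trans_eq (mul_one _).symm)
      ring
    have a3 := le_of_mul_le_mul_left a2 (by positivity)
    have a4 : (16:ℝ) ^ 6 ≤ M ^ 6 := by gcongr
    norm_num at a3 a4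
    linarith
  have hn : ∀ h ∈ Finset.Ioc 0 ⌊D⌋₊, ‖∑ m ∈ (Finset.Ioc ⌊M₁⌋₊ ⌊M⌋₊).filter (fun m => h < m),
            Complex.exp (2 * Real.pi * T * Complex.I *
              Real.log (((m:ℝ) + h) / ((m:ℝ) - h)))‖ ≤ C * (M / D) := by
    intro h hh
    obtain ⟨hh0, hhD⟩ := Finset.mem_Ioc.mp hh
    have hh1 : (1:ℝ) ≤ h := by exact_mod_cast hh0
    have hhD' : (h:ℝ) ≤ D := le_trans (by exact_mod_cast hhD) hfl
    have hlt : ∀ m ∈ Finset.Ioc ⌊M₁⌋₊ ⌊M⌋₊, h < m := by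
      intro m hm
      have := (Finset.mem_Ioc.mp hm).1
      have := Nat.lt_of_floor_lt this
      have : (h:ℝ) < m := by linarith
      exact_mod_cast this
    rw [Finset.filter_true_of_mem hlt, Finset.sum_congr rfl (fun m hm => summand_eq hh0 (hlt m hm))]
    exact pc T h M D M₁ ⟨hT, hh1, hM16, by linarith, hMT2⟩ hhD' hD9 hM1 hM1'
  refine (norm_sum_le_of_le _ hn).trans ?_
  rw [Finset.sum_const, nsmul_eq_mul, Nat.card_Ioc, Nat.sub_zero]
  calc (⌊D⌋₊:ℝ) * (C * (M / D)) ≤ D * (C * (M / D)) := by gcongr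
    _ = C * M := by field_simp
    _ ≤ _ := by nlinarith
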